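/- Let (G, ·, ∘) be a finite skew left brace such that (G, ∘) is nilpotent. Then (G, ·) is solvable. -/

import Mathlib

namespace KW

set_option linter.unusedSectionVars false
set_option linter.style.haveILetI false

open Subgroup

/-- `P` is a Sylow `p`-subgroup of the subgroup `H`. -/
structure IsSyl {G : Type*} [Group G] (p : ℕ) (P H : Subgroup G) : Prop where
  le : P ≤ H
  pg : IsPGroup p P
  ndvd : ¬ p ∣ P.relIndex H

section basic
variable {G : Type*} [Group G]

theorem isPGroup_iff_mem {p : ℕ} {P : Subgroup G} :
    IsPGroup p P ↔ ∀ g ∈ P, ∃ k : ℕ, g ^ p ^ k = 1 := by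
  constructor
  · intro h g hg
    obtain ⟨k, hk⟩ := h ⟨g, hg⟩
    exact ⟨k, by simpa using congrArg Subtype.val hk⟩
  · rintro h ⟨g, hg⟩
    obtain ⟨k, hk⟩ := h g hg
    exact ⟨k, Subtype.ext (by simpa using hk)⟩

theorem isPGroup_subgroupOf {p : ℕ} {P H : Subgroup G} (h : IsPGroup p P) :
    IsPGroup p (P.subgroupOf H) := by
  rw [isPGroup_iff_mem] at *
  rintro ⟨g, hg⟩ hgP
  obtain ⟨k, hk⟩ := h g (by simpa [mem_subgroupOf] using hgP)
  exact ⟨k, Subtype.ext (by simpa using hk)⟩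

theorem isPGroup_map {p : ℕ} {G' : Type*} [Group G'] {P : Subgroup G} (h : IsPGroup p P)
    (f : G →* G') : IsPGroup p (P.map f) := h.map f

theorem IsSyl.conj_le [Finite G] {p : ℕ} [Fact p.Prime] {P H Q : Subgroup G} (hP : IsSyl p P H)
    (hQH : Q ≤ H) (hQ : IsPGroup p Q) : ∃ h ∈ H, ∀ x ∈ Q, h * x * h⁻¹ ∈ P := by
  obtain ⟨R, hR⟩ := (isPGroup_subgroupOf (H := H) hQ).exists_le_sylow
  let S : Sylow p H := (isPGroup_subgroupOf (H := H) hP.pg).toSylow hP.ndvd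
  obtain ⟨g, hg⟩ := MulAction.exists_smul_eq H R S
  refine ⟨g, g.2, fun x hx => ?_⟩
  have h1 : (⟨x, hQH hx⟩ : H) ∈ (R : Subgroup H) := hR (by simpa [mem_subgroupOf] using hx)
  have h2 : g * ⟨x, hQH hx⟩ * g⁻¹ ∈ (S : Subgroup H) := by
    rw [← hg]
    exact Subgroup.smul_mem_pointwise_smul _ (MulAut.conj g) _ h1
  have h3 : g * ⟨x, hQH hx⟩ * g⁻¹ ∈ P.subgroupOf H := h2
  simpa [mem_subgroupOf] using h3

theorem exists_isSyl [Finite G] {p : ℕ} [Fact p.Prime] {Q H : Subgroup G}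
    (hQH : Q ≤ H) (hQ : IsPGroup p Q) : ∃ P, IsSyl p P H ∧ Q ≤ P := by
  obtain ⟨R, hR⟩ := (isPGroup_subgroupOf (H := H) hQ).exists_le_sylow
  refine ⟨(R : Subgroup H).map H.subtype, ⟨?_, ?_, ?_⟩, ?_⟩
  · rintro _ ⟨x, -, rfl⟩; exact x.2
  · exact R.2.map _
  · have : ((R : Subgroup H).map H.subtype).subgroupOf H = R := by
      ext x; simp [mem_subgroupOf]
    rw [relIndex, this]
    exact R.not_dvd_index
  · intro x hx
    exact ⟨⟨x, hQH hx⟩, hR (by simpa [mem_subgroupOf] using hx), rfl⟩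

theorem IsSyl.mono [Finite G] {p : ℕ} {P K H : Subgroup G} (hP : IsSyl p P H) (hPK : P ≤ K)
    (hKH : K ≤ H) : IsSyl p P K :=
  ⟨hPK, hP.pg, fun h => hP.ndvd (by
    rw [← relIndex_mul_relIndex P K H hPK hKH]; exact h.mul_right _)⟩

theorem IsSyl.card [Finite G] {p : ℕ} [hp : Fact p.Prime] {P H : Subgroup G} (hP : IsSyl p P H) :
    Nat.card P = p ^ (Nat.card H).factorization p := by
  have h := ((isPGroup_subgroupOf (H := H) hP.pg).toSylow hP.ndvd).card_eq_multiplicity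
  rw [← h]
  exact Nat.card_congr (subgroupOfEquivOfLe hP.le).symm.toEquiv

theorem isSyl_of_card [Finite G] {p : ℕ} [hp : Fact p.Prime] {P H : Subgroup G} (hle : P ≤ H)
    (h : Nat.card P = p ^ (Nat.card H).factorization p) : IsSyl p P H := by
  refine ⟨hle, IsPGroup.of_card h, fun hd => ?_⟩
  have h1 : Nat.card P * P.relIndex H = Nat.card H := by
    have := relIndex_mul_relIndex ⊥ P H bot_le hle
    simpa using this
  have h2 := Nat.pow_succ_factorization_not_dvd (n := Nat.card H) Nat.card_pos.ne' hp.out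
  apply h2
  rw [pow_succ, ← h]
  conv_rhs => rw [← h1]
  exact Nat.mul_dvd_mul_left _ hd

/-- elements of a `p`-subgroup (closed under conj by H) lie in the Sylow -/
theorem IsSyl.normal_le [Finite G] {p : ℕ} [Fact p.Prime] {P H Q : Subgroup G} (hP : IsSyl p P H)
    (hQH : Q ≤ H) (hQ : IsPGroup p Q) (hn : H ≤ normalizer (Q : Set G)) : Q ≤ P := by
  obtain ⟨h, hh, hc⟩ := hP.conj_le hQH hQ
  intro x hx
  have := hc (h⁻¹ * x * h) (by
    have := (mem_normalizer_iff.1 (hn (H.inv_mem hh)) x).1 hx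
    simpa using this)
  simpa [mul_assoc] using this

theorem mem_norm_of_conj [Finite G] {Q : Subgroup G} {g : G} (h : ∀ x ∈ Q, g * x * g⁻¹ ∈ Q) :
    g ∈ normalizer (Q : Set G) := by
  have hm : Q.map (MulAut.conj g).toMonoidHom ≤ Q := by
    rintro _ ⟨x, hx, rfl⟩; exact h x hx
  have he : Q.map (MulAut.conj g).toMonoidHom = Q := by
    apply eq_of_le_of_card_ge hm
    rw [card_map_of_injective (MulAut.conj g).injective]
  rw [mem_normalizer_iff]
  intro x
  refine ⟨h x, fun hx => ?_⟩
  rw [← he] at hx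
  obtain ⟨y, hy, hyx⟩ := hx
  have : y = x := by
    have : g * y * g⁻¹ = g * x * g⁻¹ := hyx
    simpa using this
  exact this ▸ hy

theorem conj_mem {Q : Subgroup G} {g x : G} (hg : g ∈ normalizer (Q : Set G)) (hx : x ∈ Q) :
    g * x * g⁻¹ ∈ Q := (mem_normalizer_iff.1 hg x).1 hx

/-- two Sylow subgroups of `H` are conjugate -/
theorem IsSyl.conj_mem_iff [Finite G] {p : ℕ} [Fact p.Prime] {P H Q : Subgroup G}
    (hP : IsSyl p P H) (hQ : IsSyl p Q H) : ∃ h ∈ H, ∀ x, x ∈ Q ↔ h * x * h⁻¹ ∈ P := by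
  obtain ⟨h, hh, hc⟩ := hP.conj_le hQ.le hQ.pg
  refine ⟨h, hh, fun x => ⟨hc x, fun hx => ?_⟩⟩
  have hm : Q.map (MulAut.conj h).toMonoidHom ≤ P := by
    rintro _ ⟨x, hx, rfl⟩; exact hc x hx
  have he : Q.map (MulAut.conj h).toMonoidHom = P := by
    apply eq_of_le_of_card_ge hm
    rw [card_map_of_injective (MulAut.conj h).injective, hP.card, hQ.card]
  rw [← he] at hx
  obtain ⟨y, hy, hyx⟩ := hx
  have : y = x := by
    have : h * y * h⁻¹ = h * x * h⁻¹ := hyx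
    simpa using this
  exact this ▸ hy

/-- A prime divisor gives an element of that order. -/
theorem exists_mem_orderOf [Finite G] {p : ℕ} [Fact p.Prime] {H : Subgroup G}
    (h : p ∣ Nat.card H) : ∃ x ∈ H, orderOf x = p := by
  obtain ⟨x, hx⟩ := exists_prime_orderOf_dvd_card' (G := H) p h
  exact ⟨x, x.2, by simpa using hx⟩

theorem isPGroup_zpowers {p : ℕ} {g : G} (h : ∃ k : ℕ, g ^ p ^ k = 1) :
    IsPGroup p (zpowers g) := by
  obtain ⟨k, hk⟩ := h
  rw [isPGroup_iff_mem]
  rintro _ ⟨n, rfl⟩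
  refine ⟨k, ?_⟩
  change (g ^ n) ^ p ^ k = 1
  rw [← zpow_natCast, ← zpow_mul, mul_comm, zpow_mul, zpow_natCast, hk, one_zpow]

end basic

/-! The primary components of a nilpotent subgroup -/

section pp
variable {G : Type*} [Group G]

/-- the intersection of all Sylow subgroups -/
def Op (p : ℕ) (G : Type*) [Group G] : Subgroup G := ⨅ P : Sylow p G, (P : Subgroup G)

/-- the `p`-core of a subgroup, as a subgroup of the ambient group -/
def pp (A : Subgroup G) (p : ℕ) : Subgroup G := (Op p A).map A.subtype

theorem pp_le (A : Subgroup G) (p : ℕ) : pp A p ≤ A := by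
  rintro _ ⟨x, -, rfl⟩; exact x.2

theorem pp_isPGroup (A : Subgroup G) (p : ℕ) : IsPGroup p (pp A p) := by
  apply isPGroup_map
  obtain ⟨P⟩ : Nonempty (Sylow p A) := inferInstance
  exact P.2.to_le (iInf_le _ P)

theorem Op_conj (p : ℕ) (f : G ≃* G) {x : G} (hx : x ∈ Op p G) : f x ∈ Op p G := by
  rw [Op, mem_iInf] at *
  intro P
  let Q : Sylow p G := P.comapOfInjective f.toMonoidHom f.injective (by
    rw [MonoidHom.range_eq_top.2 f.surjective]; exact le_top)
  have := hx Q
  exact this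

/-- maximality: normal `p`-subgroups of `A` are in `pp A p`. -/
theorem le_pp [Finite G] {A Q : Subgroup G} {p : ℕ} [Fact p.Prime] (hQA : Q ≤ A)
    (hQ : IsPGroup p Q) (hn : A ≤ normalizer (Q : Set G)) : Q ≤ pp A p := by
  intro x hx
  refine ⟨⟨x, hQA hx⟩, ?_, rfl⟩
  rw [SetLike.mem_coe, Op, mem_iInf]
  intro P
  have hP : IsSyl p ((P : Subgroup A).map A.subtype) A := by
    refine ⟨?_, P.2.map _, ?_⟩
    · rintro _ ⟨x, -, rfl⟩; exact x.2
    · have : ((P : Subgroup A).map A.subtype).subgroupOf A = P := by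
        ext x; simp [mem_subgroupOf]
      rw [relIndex, this]
      exact P.not_dvd_index
  have := hP.normal_le hQA hQ hn hx
  obtain ⟨y, hy, hyx⟩ := this
  have : y = ⟨x, hQA hx⟩ := Subtype.ext hyx
  exact this ▸ hy

theorem normalizer_le_normalizer_pp [Finite G] (A : Subgroup G) (p : ℕ) :
    normalizer (A : Set G) ≤ normalizer (pp A p : Set G) := by
  intro g hg
  apply mem_norm_of_conj
  rintro _ ⟨x, hx, rfl⟩
  let f : A ≃* A := MulAut.conjNormal (H := A.subgroupOf (normalizer (A : Set G)))
    |> fun _ => 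
      { toFun := fun y => ⟨g * y * g⁻¹, conj_mem hg y.2⟩
        invFun := fun y => ⟨g⁻¹ * y * g, by simpa using conj_mem (inv_mem hg) y.2⟩
        left_inv := fun y => Subtype.ext (by simp [mul_assoc])
        right_inv := fun y => Subtype.ext (by simp [mul_assoc])
        map_mul' := fun y z => Subtype.ext (by simp [mul_assoc]) }
  exact ⟨f x, Op_conj p f hx, rfl⟩

theorem le_normalizer_pp [Finite G] (A : Subgroup G) (p : ℕ) :
    A ≤ normalizer (pp A p : Set G) := le_normalizer.trans (normalizer_le_normalizer_pp A p)

variable [Finite G] {A : Subgroup G}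

theorem pp_isSyl (hA : Group.IsNilpotent A) (p : ℕ) [Fact p.Prime] : IsSyl p (pp A p) A := by
  obtain ⟨P, hP, -⟩ := exists_isSyl (p := p) (H := A) (bot_le) (IsPGroup.of_bot)
  have : P ≤ pp A p := by
    apply le_pp hP.le hP.pg
    have hn : ∀ (p : ℕ), Fact (Nat.Prime p) → ∀ (P : Sylow p A), (P : Subgroup A).Normal :=
      (Group.isNilpotent_of_finite_tfae.out 0 3).1 hA
    have h2 := hn p inferInstance ((isPGroup_subgroupOf (H := A) hP.pg).toSylow hP.ndvd)
    have h3 : (P.subgroupOf A).Normal := h2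
    exact (normal_subgroupOf_iff_le_normalizer hP.le).1 h3
  refine ⟨pp_le A p, pp_isPGroup A p, fun h => hP.ndvd ?_⟩
  rw [← relIndex_mul_relIndex P _ A this (pp_le A p)]
  exact h.mul_left _

theorem mem_pp (hA : Group.IsNilpotent A) {p : ℕ} [Fact p.Prime] {x : G} (hx : x ∈ A)
    (h : ∃ k : ℕ, x ^ p ^ k = 1) : x ∈ pp A p := by
  obtain ⟨a, ha, hc⟩ := (pp_isSyl hA p).conj_le (Q := zpowers x) (by simpa using hx)
    (isPGroup_zpowers h)
  have h1 := hc x (mem_zpowers x)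
  have := conj_mem (inv_mem (le_normalizer_pp A p ha)) h1
  simpa [mul_assoc] using this

theorem le_pp_of_isPGroup (hA : Group.IsNilpotent A) {p : ℕ} [Fact p.Prime] {Q : Subgroup G}
    (hQA : Q ≤ A) (h : IsPGroup p Q) : Q ≤ pp A p := fun x hx =>
  mem_pp hA (hQA hx) (isPGroup_iff_mem.1 h x hx)

theorem disj_of_pgroups {p q : ℕ} [hp : Fact p.Prime] [hq : Fact q.Prime] (hpq : p ≠ q) {x : G}
    (h : ∃ k : ℕ, x ^ p ^ k = 1) (h' : ∃ k : ℕ, x ^ q ^ k = 1) : x = 1 := by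
  obtain ⟨k, hk⟩ := h
  obtain ⟨l, hl⟩ := h'
  have h1 := orderOf_dvd_of_pow_eq_one hk
  have h2 := orderOf_dvd_of_pow_eq_one hl
  have : Nat.Coprime (p ^ k) (q ^ l) := Nat.Coprime.pow _ _ ((Nat.coprime_primes hp.out hq.out).2 hpq)
  exact orderOf_eq_one_iff.1 (Nat.eq_one_of_dvd_coprimes this h1 h2)

theorem pp_comm {p q : ℕ} [hp : Fact p.Prime] [hq : Fact q.Prime] (hpq : p ≠ q) {x y : G}
    (hx : x ∈ pp A p) (hy : y ∈ pp A q) : x * y = y * x := by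
  have h1 : x * y * x⁻¹ * y⁻¹ ∈ pp A p := by
    have : y * x⁻¹ * y⁻¹ ∈ pp A p := conj_mem (le_normalizer_pp A p (pp_le A q hy)) (inv_mem hx)
    simpa [mul_assoc] using mul_mem hx this
  have h2 : x * y * x⁻¹ * y⁻¹ ∈ pp A q :=
    mul_mem (conj_mem (le_normalizer_pp A q (pp_le A p hx)) hy) (inv_mem hy)
  have := disj_of_pgroups hpq (isPGroup_iff_mem.1 (pp_isPGroup A p) _ h1)
    (isPGroup_iff_mem.1 (pp_isPGroup A q) _ h2)
  rw [mul_inv_eq_one] at this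
  exact mul_inv_eq_iff_eq_mul.1 this

theorem pp_card (hA : Group.IsNilpotent A) (p : ℕ) [Fact p.Prime] :
    Nat.card (pp A p) = p ^ (Nat.card A).factorization p := (pp_isSyl hA p).card

theorem pp_ne_bot (hA : Group.IsNilpotent A) {p : ℕ} [hp : Fact p.Prime] (h : p ∣ Nat.card A) :
    pp A p ≠ ⊥ := by
  intro hb
  have := pp_card hA p
  rw [hb] at this
  simp only [card_bot] at this
  have h1 : (Nat.card A).factorization p ≠ 0 := (hp.out.factorization_pos_of_dvd Nat.card_pos.ne' h).ne'
  have := (Nat.pow_eq_one.1 this.symm)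
  rcases this with h | h
  · exact hp.out.one_lt.ne' h
  · exact h1 h

theorem dvd_card_of_mem {p : ℕ} [hp : Fact p.Prime] {H : Subgroup G} {x : G} (hx : x ∈ H)
    (h1 : x ≠ 1) (h : ∃ k : ℕ, x ^ p ^ k = 1) : p ∣ Nat.card H := by
  obtain ⟨k, hk⟩ := h
  have h2 := orderOf_dvd_of_pow_eq_one hk
  obtain ⟨j, -, hj⟩ := (Nat.dvd_prime_pow hp.out).1 h2
  have h3 : orderOf x ∣ Nat.card H := by
    have := orderOf_dvd_natCard (⟨x, hx⟩ : H)
    simpa using this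
  refine dvd_trans ?_ h3
  rw [hj]
  rcases j with _ | j
  · exact absurd (orderOf_eq_one_iff.1 (by simpa using hj)) h1
  · exact dvd_pow_self p (Nat.succ_ne_zero j)

/-- A nilpotent group is generated by its primary parts. -/
theorem le_of_pp_le (hA : Group.IsNilpotent A) {M : Subgroup G}
    (h : ∀ p : ℕ, p.Prime → p ∣ Nat.card A → pp A p ≤ M) : A ≤ M := by
  have hc : Nat.card A ∣ Nat.card (M ⊓ A : Subgroup G) := by
    rw [← Nat.factorization_prime_le_iff_dvd Nat.card_pos.ne' Nat.card_pos.ne']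
    intro p hp
    haveI := Fact.mk hp
    by_cases hd : p ∣ Nat.card A
    · rw [← hp.pow_dvd_iff_le_factorization Nat.card_pos.ne', ← pp_card hA p]
      exact card_dvd_of_le (le_inf (h p hp hd) (pp_le A p))
    · rw [Nat.factorization_eq_zero_of_not_dvd hd]; exact Nat.zero_le _
  have := eq_of_le_of_card_ge (inf_le_right : M ⊓ A ≤ A) (Nat.le_of_dvd Nat.card_pos hc)
  rw [← this]; exact inf_le_left

/-- A normal nontrivial subgroup of the p-part meets the center of `A`. -/
theorem exists_central {p : ℕ} [hp : Fact p.Prime] (hA : Group.IsNilpotent A)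
    {E : Subgroup G} (hE : E ≤ pp A p) (hne : E ≠ ⊥) (hn : pp A p ≤ normalizer (E : Set G)) :
    ∃ z ∈ E, z ≠ 1 ∧ ∀ a ∈ A, a * z = z * a := by
  let P := pp A p
  have hnE : (E.subgroupOf P).Normal := (normal_subgroupOf_iff_le_normalizer hE).2 hn
  have hP : IsPGroup p P := pp_isPGroup A p
  have hnil : Group.IsNilpotent P := hP.isNilpotent
  have hdvd : p ∣ Nat.card (E.subgroupOf P) := by
    obtain ⟨x, hx, hx1⟩ := (E.ne_bot_iff_exists_ne_one).1 hne |> fun ⟨x, hx⟩ => (⟨x, x.2, by simpa using hx⟩ : ∃ x : G, x ∈ E ∧ x ≠ 1)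
    have := dvd_card_of_mem (p := p) (H := E.subgroupOf P) (x := ⟨x, hE hx⟩)
      (by simpa [mem_subgroupOf] using hx) (by simpa [Subtype.ext_iff] using hx1) (hP _)
    exact this
  obtain ⟨z, hz, hz1⟩ :=
    (hP.of_equiv ConjAct.toConjAct).exists_fixed_point_of_prime_dvd_card_of_fixed_point
      (α := E.subgroupOf P) hdvd (a := (1 : E.subgroupOf P)) (by
        intro g
        rw [smul_one])
  have hzE : (z : P).1 ∈ E := mem_subgroupOf.1 z.2
  refine ⟨(z : P).1, hzE, ?_, ?_⟩
  · intro h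
    apply hz1
    ext
    exact h.symm
  · have : A ≤ centralizer {((z : P).1 : G)} := by
      apply le_of_pp_le hA
      intro q hq _ a ha
      rw [mem_centralizer_singleton_iff]
      haveI := Fact.mk hq
      by_cases hpq : p = q
      · subst hpq
        have h1 := hz (ConjAct.toConjAct ⟨a, ha⟩)
        have h2 := congrArg (fun w : E.subgroupOf P => ((w : P) : G)) h1
        have h3 : a * (z : P).1 * a⁻¹ = (z : P).1 := h2
        exact mul_inv_eq_iff_eq_mul.1 h3
      · exact (pp_comm hpq (hE hzE) ha).symm
    intro a ha
    exact mem_centralizer_singleton_iff.1 (this ha)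

end pp
end KW

namespace KW

open Subgroup

set_option linter.unusedSectionVars false
set_option linter.style.haveILetI false

section gen
variable {G : Type*} [Group G]

theorem exists_ne_one {E : Subgroup G} (h : E ≠ ⊥) : ∃ x ∈ E, x ≠ 1 := by
  obtain ⟨x, hx⟩ := (E.ne_bot_iff_exists_ne_one).1 h
  exact ⟨x, x.2, by simpa using hx⟩

theorem normal_of_normalizer {N : Subgroup G} (h : ∀ g, g ∈ normalizer (N : Set G)) : N.Normal :=
  ⟨fun _ hn g => conj_mem (h g) hn⟩

theorem normalizer_of_normal {N : Subgroup G} (h : N.Normal) (g : G) :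
    g ∈ normalizer (N : Set G) := by
  rw [normalizer_eq_top]; trivial

theorem solv_mono {H K : Subgroup G} (h : H ≤ K) (hK : Group.IsSolvable K) : Group.IsSolvable H :=
  Group.isSolvable_of_isSolvable_injective (f := inclusion h) (inclusion_injective h)

theorem nilp_mono {H K : Subgroup G} (h : H ≤ K) (hK : Group.IsNilpotent K) :
    Group.IsNilpotent H := by
  have : Group.IsNilpotent (H.subgroupOf K) := inferInstance
  exact Group.nilpotent_of_mulEquiv (subgroupOfEquivOfLe h)

variable [Finite G]

/-- nontrivial solvable group has a nontrivial normal `l`-subgroup -/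
theorem exists_normal_pgroup [Nontrivial G] (hs : Group.IsSolvable G) :
    ∃ (l : ℕ) (_ : l.Prime) (N : Subgroup G), N.Normal ∧ N ≠ ⊥ ∧ IsPGroup l N := by
  have hf : ({N : Subgroup G | N.Normal ∧ N ≠ ⊥}).Finite := Set.toFinite _
  obtain ⟨N, hN⟩ := hf.exists_minimal ⟨⊤, inferInstance, top_ne_bot⟩
  have hNn : N.Normal := hN.prop.1
  have hlt := Group.IsSolvable.commutator_lt_of_ne_bot hN.prop.2
  have hb : ⁅N, N⁆ = ⊥ := by
    by_contra hne
    exact absurd (hN.le_of_le (y := ⁅N, N⁆) ⟨inferInstance, hne⟩ hlt.le) (not_le_of_gt hlt)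
  have hcomm : ∀ a b : N, a * b = b * a := by
    intro a b
    have := commutator_eq_bot_iff_le_centralizer.1 hb a.2
    exact Subtype.ext (mem_centralizer_iff.1 this b b.2).symm
  letI : CommGroup N := { (inferInstance : Group N) with mul_comm := hcomm }
  have hnil : Group.IsNilpotent N := inferInstance
  have hc : Nat.card N ≠ 1 := by
    intro h; exact hN.prop.2 (card_eq_one.1 h)
  obtain ⟨l, hl, hd⟩ := Nat.exists_prime_and_dvd hc
  haveI := Fact.mk hl
  refine ⟨l, hl, pp N l, ?_, pp_ne_bot hnil hd, pp_isPGroup N l⟩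
  exact normal_of_normalizer fun g => normalizer_le_normalizer_pp N l (normalizer_of_normal hNn g)

end gen

theorem exists_hall_aux (σ : ℕ → Prop) (n : ℕ) : ∀ (H : Type u) [Group H] [Finite H],
    Nat.card H ≤ n → Group.IsSolvable H →
    ∃ T : Subgroup H, (∀ r, r.Prime → r ∣ Nat.card T → σ r) ∧
      (∀ r, r.Prime → r ∣ T.index → ¬ σ r) := by
  induction n with
  | zero => intro H _ _ h; have : 0 < Nat.card H := Nat.card_pos; omega
  | succ n ih =>
    intro H _ _ hn hs
    rcases subsingleton_or_nontrivial H with hsub | hnt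
    · refine ⟨⊥, fun r hr hd => ?_, fun r hr hd => ?_⟩
      · simp at hd; exact absurd hd hr.one_lt.ne'
      · have : (⊥ : Subgroup H).index = 1 := by rw [index_bot]; exact Nat.card_of_subsingleton (1 : H)
        rw [this] at hd; simp at hd; exact absurd hd hr.one_lt.ne'
    obtain ⟨l, hl, N, hN, hNb, hNp⟩ := exists_normal_pgroup hs
    haveI := Fact.mk hl
    have hcN : 1 < Nat.card N := by
      rcases (Nat.lt_or_ge 1 (Nat.card N)) with h | h
      · exact h
      · exact absurd (card_eq_one.1 (le_antisymm h Nat.card_pos)) hNb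
    have hcard := card_eq_card_quotient_mul_card_subgroup N
    have hq0 : 0 < Nat.card (H ⧸ N) := Nat.card_pos
    have hlt : Nat.card (H ⧸ N) ≤ n := by nlinarith
    obtain ⟨T, hT1, hT2⟩ := ih (H ⧸ N) hlt inferInstance
    set T' : Subgroup H := T.comap (QuotientGroup.mk' N) with hT'
    have hi : T'.index = T.index := index_comap_of_surjective _ (QuotientGroup.mk'_surjective N)
    have h1 := card_mul_index T'
    have h2 := card_mul_index T
    have hi0 : 0 < T.index := Nat.pos_of_ne_zero index_ne_zero_of_finite
    have hc : Nat.card T' = Nat.card N * Nat.card T := by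
      apply Nat.eq_of_mul_eq_mul_right hi0
      rw [← hi, h1, hcard, ← h2, hi]; ring
    obtain ⟨k, hk⟩ := IsPGroup.iff_card.1 hNp
    have hpl : ∀ r, r.Prime → r ∣ Nat.card N → r = l := by
      intro r hr hd
      rw [hk] at hd
      exact (Nat.prime_dvd_prime_iff_eq hr hl).1 (hr.dvd_of_dvd_pow hd)
    by_cases hσ : σ l
    · refine ⟨T', fun r hr hd => ?_, fun r hr hd => hT2 r hr (hi ▸ hd)⟩
      rw [hc, hr.dvd_mul] at hd
      rcases hd with hd | hd
      · exact hpl r hr hd ▸ hσ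
      · exact hT1 r hr hd
    · have hNT : N ≤ T' := by
        intro x hx
        have : QuotientGroup.mk' N x = 1 := (QuotientGroup.eq_one_iff x).2 hx
        rw [hT', mem_comap, this]; exact one_mem _
      have hNn : (N.subgroupOf T').Normal := inferInstance
      have hcN' : Nat.card (N.subgroupOf T') = Nat.card N :=
        Nat.card_congr (subgroupOfEquivOfLe hNT).toEquiv
      have h3 := card_mul_index (N.subgroupOf T')
      have hiN : (N.subgroupOf T').index = Nat.card T := by
        apply Nat.eq_of_mul_eq_mul_left (show 0 < Nat.card N from Nat.card_pos)
        rw [← hcN', h3, hc, hcN']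
      obtain ⟨K, hK⟩ := exists_right_complement'_of_coprime (N := N.subgroupOf T') (by
        rw [hcN', hiN]
        apply Nat.coprime_of_dvd
        intro r hr hd1 hd2
        exact hσ (hpl r hr hd1 ▸ hT1 r hr hd2))
      have h4 := hK.card_mul_card
      have hcK : Nat.card K = Nat.card T := by
        apply Nat.eq_of_mul_eq_mul_left (show 0 < Nat.card N from Nat.card_pos)
        rw [← hcN', h4, hc, hcN']
      have hcK' : Nat.card (K.map T'.subtype) = Nat.card T := by
        rw [card_map_of_injective T'.subtype_injective, hcK]
      have h5 := card_mul_index (K.map T'.subtype)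
      have hiK : (K.map T'.subtype).index = Nat.card N * T.index := by
        apply Nat.eq_of_mul_eq_mul_left (show 0 < Nat.card T from Nat.card_pos)
        rw [← hcK', h5, hcard, ← h2, hcK']; ring
      refine ⟨K.map T'.subtype, fun r hr hd => hT1 r hr (hcK' ▸ hd), fun r hr hd => ?_⟩
      rw [hiK, hr.dvd_mul] at hd
      rcases hd with hd | hd
      · exact hpl r hr hd ▸ hσ
      · exact hT2 r hr hd

section gen2
variable {G : Type*} [Group G] [Finite G]

theorem exists_hall (σ : ℕ → Prop) (H : Subgroup G) (hs : Group.IsSolvable H) :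
    ∃ T ≤ H, (∀ r, r.Prime → r ∣ Nat.card T → σ r) ∧
      (∀ r, r.Prime → r ∣ T.relIndex H → ¬ σ r) := by
  obtain ⟨T, h1, h2⟩ := exists_hall_aux σ _ H le_rfl hs
  refine ⟨T.map H.subtype, ?_, ?_, ?_⟩
  · rintro _ ⟨x, -, rfl⟩; exact x.2
  · intro r hr hd
    rw [card_map_of_injective H.subtype_injective] at hd
    exact h1 r hr hd
  · have : (T.map H.subtype).subgroupOf H = T := by
      ext x; simp [mem_subgroupOf]
    rw [relIndex, this]
    exact h2

/-- Lemma C: in a solvable group with no nontrivial normal `l`-subgroups (`l ≠ p`),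
elements centralizing the `p`-core are `p`-elements. -/
theorem lemmaC (hs : Group.IsSolvable G) {p : ℕ} [hp : Fact p.Prime]
    (h : ∀ l, l.Prime → l ≠ p → ∀ N : Subgroup G, N.Normal → IsPGroup l N → N = ⊥) :
    IsPGroup p (centralizer (pp (⊤ : Subgroup G) p : Set G)) := by
  by_contra hC
  have htop : ∀ g : G, g ∈ normalizer (pp (⊤ : Subgroup G) p : Set G) := fun g =>
    le_normalizer_pp ⊤ p (mem_top g)
  have hn : (pp (⊤ : Subgroup G) p).Normal := normal_of_normalizer htop
  set F := pp (⊤ : Subgroup G) p with hF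
  have hf : ({N : Subgroup G | N.Normal ∧ N ≤ centralizer (F : Set G) ∧ ¬ IsPGroup p N}).Finite :=
    Set.toFinite _
  obtain ⟨N, hN⟩ := hf.exists_minimal ⟨_, inferInstance, le_rfl, hC⟩
  obtain ⟨hNn, hNC, hNp⟩ := hN.prop
  have hNb : N ≠ ⊥ := by
    rintro rfl; exact hNp IsPGroup.of_bot
  have hlt := Group.IsSolvable.commutator_lt_of_ne_bot hNb
  have hD : IsPGroup p (⁅N, N⁆ : Subgroup G) := by
    by_contra hne
    exact absurd (hN.le_of_le (y := ⁅N, N⁆) ⟨inferInstance, hlt.le.trans hNC, hne⟩ hlt.le)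
      (not_le_of_gt hlt)
  have hDF : ⁅N, N⁆ ≤ F := le_pp le_top hD (fun g _ => normalizer_of_normal inferInstance g)
  have hnil : Group.IsNilpotent N := by
    refine Subgroup.isNilpotent_of_ker_le_center (Abelianization.of (G := N)) ?_
    rw [Abelianization.ker_of]
    intro x hx
    rw [mem_center_iff]
    intro y
    have hx' : (x : G) ∈ ⁅N, N⁆ := by
      rw [commutator_def] at hx
      have := mem_map_of_mem N.subtype hx
      rw [map_commutator, ← MonoidHom.range_eq_map, range_subtype] at this
      simpa using this
    exact Subtype.ext (mem_centralizer_iff.1 (hNC y.2) x (hDF hx')).symm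
  apply hNp
  have : N ≤ pp N p := by
    apply le_of_pp_le hnil
    intro l hl _
    haveI := Fact.mk hl
    by_cases hlp : l = p
    · subst hlp; exact le_rfl
    · rw [h l hl hlp (pp N l) (normal_of_normalizer fun g =>
        normalizer_le_normalizer_pp N l (normalizer_of_normal hNn g)) (pp_isPGroup N l)]
      exact bot_le
  exact (pp_isPGroup N p).to_le this

end gen2

end KW

namespace KW

open Subgroup

set_option linter.unusedSectionVars false
set_option linter.style.haveILetI false

section fac
variable {G : Type*} [Group G] [Finite G]

theorem disj_of_cop {X Z : Subgroup G} (cop : Nat.Coprime (Nat.card X) (Nat.card Z)) {x : G}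
    (hx : x ∈ X) (hz : x ∈ Z) : x = 1 := by
  have h1 : orderOf x ∣ Nat.card X := by simpa using orderOf_dvd_natCard (⟨x, hx⟩ : X)
  have h2 : orderOf x ∣ Nat.card Z := by simpa using orderOf_dvd_natCard (⟨x, hz⟩ : Z)
  exact orderOf_eq_one_iff.1 (Nat.eq_one_of_dvd_coprimes cop h1 h2)

theorem card_prod {H X Z : Subgroup G} (hX : X ≤ H) (hZ : Z ≤ H)
    (cop : Nat.Coprime (Nat.card X) (Nat.card Z))
    (pr : ∀ h ∈ H, ∃ x ∈ X, ∃ z ∈ Z, h = x * z) : Nat.card H = Nat.card X * Nat.card Z := by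
  rw [← Nat.card_prod]
  symm
  refine Nat.card_eq_of_bijective (fun w : X × Z => (⟨w.1 * w.2, mul_mem (hX w.1.2) (hZ w.2.2)⟩ : H))
    ⟨?_, ?_⟩
  · rintro ⟨⟨x, hx⟩, ⟨z, hz⟩⟩ ⟨⟨x', hx'⟩, ⟨z', hz'⟩⟩ h
    have h1 : x * z = x' * z' := congrArg Subtype.val h
    have h2 : x'⁻¹ * x = z' * z⁻¹ := by
      rw [inv_mul_eq_iff_eq_mul, ← mul_assoc, ← h1]; simp
    have h3 : x'⁻¹ * x = 1 := disj_of_cop cop (mul_mem (inv_mem hx') hx)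
      (h2 ▸ mul_mem hz' (inv_mem hz))
    have h4 : x' = x := inv_mul_eq_one.1 h3
    subst h4
    have h5 : z = z' := by simpa using h1
    subst h5
    rfl
  · rintro ⟨h, hh⟩
    obtain ⟨x, hx, z, hz, e⟩ := pr h hh
    exact ⟨(⟨x, hx⟩, ⟨z, hz⟩), Subtype.ext e.symm⟩

theorem sylX {H X Z : Subgroup G} (hX : X ≤ H) (hZ : Z ≤ H)
    (cop : Nat.Coprime (Nat.card X) (Nat.card Z))
    (pr : ∀ h ∈ H, ∃ x ∈ X, ∃ z ∈ Z, h = x * z) (nX : Group.IsNilpotent X) {p : ℕ}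
    [hp : Fact p.Prime] (hd : ¬ p ∣ Nat.card Z) : IsSyl p (pp X p) H := by
  apply isSyl_of_card ((pp_le X p).trans hX)
  rw [pp_card nX, card_prod hX hZ cop pr, Nat.factorization_mul Nat.card_pos.ne' Nat.card_pos.ne']
  simp [Nat.factorization_eq_zero_of_not_dvd hd]

theorem prod_symm {H X Z : Subgroup G} (pr : ∀ h ∈ H, ∃ x ∈ X, ∃ z ∈ Z, h = x * z) :
    ∀ h ∈ H, ∃ z ∈ Z, ∃ x ∈ X, h = z * x := by
  intro h hh
  obtain ⟨x, hx, z, hz, e⟩ := pr h⁻¹ (inv_mem hh)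
  exact ⟨z⁻¹, inv_mem hz, x⁻¹, inv_mem hx, by rw [← mul_inv_rev, ← e, inv_inv]⟩

theorem IsSyl.trans {p : ℕ} [hp : Fact p.Prime] {P T H : Subgroup G} (h : IsSyl p P T) (hT : T ≤ H)
    (hd : ¬ p ∣ T.relIndex H) : IsSyl p P H :=
  ⟨h.le.trans hT, h.pg, by
    rw [← relIndex_mul_relIndex P T H h.le hT, hp.out.dvd_mul]
    rintro (h1 | h1)
    · exact h.ndvd h1
    · exact hd h1⟩

/-- the standing hypotheses -/
structure Ctx (A B : Subgroup G) : Prop where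
  simple : ∀ N : Subgroup G, N.Normal → N = ⊥ ∨ N = ⊤
  cen : ∀ z : G, (∀ g, g * z = z * g) → z = 1
  nA : Group.IsNilpotent A
  nB : Group.IsNilpotent B
  cop : Nat.Coprime (Nat.card A) (Nat.card B)
  prod : ∀ g : G, ∃ a ∈ A, ∃ b ∈ B, g = a * b
  ih : ∀ H : Subgroup G, H ≠ ⊤ → ∀ X Z : Subgroup G, X ≤ H → Z ≤ H → Group.IsNilpotent X →
    Group.IsNilpotent Z → Nat.Coprime (Nat.card X) (Nat.card Z) →
    (∀ h ∈ H, ∃ x ∈ X, ∃ z ∈ Z, h = x * z) → Group.IsSolvable H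
  twoA : ∀ p : ℕ, ∃ q, q.Prime ∧ q ≠ p ∧ q ∣ Nat.card A
  twoB : ∀ p : ℕ, ∃ q, q.Prime ∧ q ≠ p ∧ q ∣ Nat.card B

variable {A B : Subgroup G}

namespace Ctx

theorem prod' (c : Ctx A B) (g : G) : ∃ b ∈ B, ∃ a ∈ A, g = b * a :=
  prod_symm (H := ⊤) (X := A) (Z := B) (fun g _ => c.prod g) g trivial

theorem symm (c : Ctx A B) : Ctx B A :=
  ⟨c.simple, c.cen, c.nB, c.nA, c.cop.symm, c.prod', c.ih, c.twoB, c.twoA⟩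

theorem not_dvd (c : Ctx A B) {p : ℕ} (hp : p.Prime) (h : p ∣ Nat.card A) : ¬ p ∣ Nat.card B :=
  fun h' => hp.one_lt.ne' (Nat.eq_one_of_dvd_coprimes c.cop h h')

theorem disj (c : Ctx A B) {x : G} (h : x ∈ A) (h' : x ∈ B) : x = 1 := disj_of_cop c.cop h h'

theorem sylTop (c : Ctx A B) {p : ℕ} [hp : Fact p.Prime] (h : p ∣ Nat.card A) :
    IsSyl p (pp A p) ⊤ :=
  sylX le_top le_top c.cop (fun g _ => c.prod g) c.nA (c.not_dvd hp.out h)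

theorem syl (c : Ctx A B) {p : ℕ} [hp : Fact p.Prime] (h : p ∣ Nat.card A) {H : Subgroup G}
    (hH : pp A p ≤ H) : IsSyl p (pp A p) H := (c.sylTop h).mono hH le_top

theorem cenA (c : Ctx A B) {p : ℕ} [hp : Fact p.Prime] (h : p ∣ Nat.card A) :
    ∃ z ∈ pp A p, z ≠ 1 ∧ ∀ a ∈ A, a * z = z * a :=
  exists_central c.nA le_rfl (pp_ne_bot c.nA h) le_normalizer

theorem L1 (c : Ctx A B) {M : Subgroup G} (hAM : A ≤ M) (hM : M ≠ ⊤) {z : G} (hz : z ∈ M)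
    (hzc : ∀ b ∈ B, b * z = z * b) : z = 1 := by
  have h1 : normalClosure {z} ≤ M := by
    rw [normalClosure, closure_le]
    intro x hx
    obtain ⟨w, hw, hc⟩ := Group.mem_conjugatesOfSet_iff.1 hx
    rw [Set.mem_singleton_iff] at hw
    subst hw
    obtain ⟨g, rfl⟩ := isConj_iff.1 hc
    obtain ⟨a, ha, b, hb, rfl⟩ := c.prod g
    have : a * b * w * (a * b)⁻¹ = a * w * a⁻¹ := by
      rw [mul_inv_rev, mul_assoc a b w, hzc b hb]; group
    rw [this]
    exact mul_mem (mul_mem (hAM ha) hz) (inv_mem (hAM ha))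
  rcases c.simple (normalClosure {z}) inferInstance with h | h
  · have : z ∈ normalClosure {z} := subset_normalClosure rfl
    rw [h] at this
    exact this
  · rw [h] at h1; exact absurd (top_le_iff.1 h1) hM

theorem normalizer_ne_top (c : Ctx A B) {E : Subgroup G} (h : E ≠ ⊥) (h' : E ≠ ⊤) :
    normalizer (E : Set G) ≠ ⊤ := by
  intro ht
  rcases c.simple E (normalizer_eq_top_iff.1 ht) with h1 | h1
  · exact h h1
  · exact h' h1

theorem A_ne_top (c : Ctx A B) : A ≠ ⊤ := by
  intro h
  obtain ⟨q, hq, -, hd⟩ := c.twoB 0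
  haveI := Fact.mk hq
  obtain ⟨z, hz, hz1, -⟩ := c.symm.cenA hd
  exact hz1 (c.disj (h ▸ mem_top z) (pp_le B q hz))

theorem ne_top_of_le (c : Ctx A B) {E : Subgroup G} (h : E ≤ A) : E ≠ ⊤ := by
  rintro rfl; exact c.A_ne_top (top_le_iff.1 h)

theorem dede (_ : Ctx A B) (pr : ∀ g : G, ∃ a ∈ A, ∃ b ∈ B, g = a * b) {M : Subgroup G}
    (hAM : A ≤ M) {m : G} (hm : m ∈ M) :
    ∃ a ∈ A, ∃ b ∈ B, b ∈ M ∧ m = a * b := by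
  obtain ⟨a, ha, b, hb, rfl⟩ := pr m
  exact ⟨a, ha, b, hb, by simpa using mul_mem (inv_mem (hAM ha)) hm, rfl⟩

theorem JG (c : Ctx A B) {p s : ℕ} [hp : Fact p.Prime] [hs : Fact s.Prime] (hpA : p ∣ Nat.card A)
    (hsB : s ∣ Nat.card B) {K L : Subgroup G} (hK : K ≤ pp A p) (hKn : A ≤ normalizer (K : Set G))
    (hK1 : K ≠ ⊥) (hL : L ≤ pp B s) (hLn : B ≤ normalizer (L : Set G)) (hJ : K ⊔ L ≠ ⊤) :
    ∃ E : Subgroup G, E ≠ ⊥ ∧ K ⊔ L ≤ normalizer (E : Set G) ∧ (E ≤ pp A p ∨ E ≤ pp B s) := by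
  set J := K ⊔ L with hJd
  have hKJ : K ≤ J := le_sup_left
  have hLJ : L ≤ J := le_sup_right
  have hJ1 : J ≠ ⊥ := fun h => hK1 (le_bot_iff.1 (h ▸ hKJ))
  set Y := normalizer (J : Set G) with hY
  have hYt : Y ≠ ⊤ := c.normalizer_ne_top hJ1 hJ
  have hJY : J ≤ Y := le_normalizer
  have hpr : ∀ h ∈ Y, ∃ x ∈ A ⊓ Y, ∃ z ∈ B ⊓ Y, h = x * z := by
    intro g hg
    obtain ⟨a, ha, b, hb, rfl⟩ := c.prod g
    have haY : a ∈ Y := by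
      apply mem_norm_of_conj
      have : J ≤ J.comap (MulAut.conj a).toMonoidHom := by
        apply sup_le
        · intro x hx
          exact hKJ (conj_mem (hKn ha) hx)
        · intro x hx
          have h1 : b⁻¹ * x * b ∈ L := by simpa using conj_mem (inv_mem (hLn hb)) hx
          have h2 := conj_mem hg (hLJ h1)
          have h3 : a * b * (b⁻¹ * x * b) * (a * b)⁻¹ = a * x * a⁻¹ := by group
          rw [h3] at h2
          exact h2
      intro x hx
      exact this hx
    exact ⟨a, ⟨ha, haY⟩, b, ⟨hb, by simpa using mul_mem (inv_mem haY) hg⟩, rfl⟩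
  have hcop : Nat.Coprime (Nat.card (A ⊓ Y : Subgroup G)) (Nat.card (B ⊓ Y : Subgroup G)) :=
    Nat.Coprime.of_dvd (card_dvd_of_le inf_le_left) (card_dvd_of_le inf_le_left) c.cop
  set X := A ⊓ Y with hX
  set Z := B ⊓ Y with hZ
  have nX : Group.IsNilpotent X := nilp_mono inf_le_left c.nA
  have nZ : Group.IsNilpotent Z := nilp_mono inf_le_left c.nB
  have hsol : Group.IsSolvable Y := c.ih Y hYt X Z inf_le_right inf_le_right nX nZ hcop hpr
  have sX : IsSyl p (pp X p) Y := sylX inf_le_right inf_le_right hcop hpr nX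
    (fun h => c.not_dvd hp.out hpA (h.trans (card_dvd_of_le inf_le_left)))
  have sZ : IsSyl s (pp Z s) Y := sylX inf_le_right inf_le_right hcop.symm (prod_symm hpr) nZ
    (fun h => c.symm.not_dvd hs.out hsB (h.trans (card_dvd_of_le inf_le_left)))
  obtain ⟨T, hTY, hT1, hT2⟩ := exists_hall (fun r => r = p ∨ r = s) Y hsol
  obtain ⟨P1, hP1, -⟩ := exists_isSyl (p := p) (H := T) bot_le IsPGroup.of_bot
  obtain ⟨S1, hS1, -⟩ := exists_isSyl (p := s) (H := T) bot_le IsPGroup.of_bot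
  obtain ⟨y1, hy1, hc1⟩ := (hP1.trans hTY (fun h => hT2 p hp.out h (Or.inl rfl))).conj_le sX.le sX.pg
  obtain ⟨y2, hy2, hc2⟩ := (hS1.trans hTY (fun h => hT2 s hs.out h (Or.inr rfl))).conj_le sZ.le sZ.pg
  obtain ⟨x, hx, z, hz, hxz⟩ := hpr (y1⁻¹ * y2) (mul_mem (inv_mem hy1) hy2)
  have hy : y1 * x = y2 * z⁻¹ := by
    rw [inv_mul_eq_iff_eq_mul] at hxz
    rw [hxz]; group
  have hKX : K ≤ pp X p := le_pp_of_isPGroup nX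
    (le_inf (hK.trans (pp_le A p)) (hKJ.trans hJY)) ((pp_isPGroup A p).to_le hK)
  have hLZ : L ≤ pp Z s := le_pp_of_isPGroup nZ
    (le_inf (hL.trans (pp_le B s)) (hLJ.trans hJY)) ((pp_isPGroup B s).to_le hL)
  have hJc : J ≤ T.comap (MulAut.conj (y1 * x)).toMonoidHom := by
    apply sup_le
    · intro w hw
      have h1 := hc1 _ (conj_mem (le_normalizer_pp X p hx) (hKX hw))
      have h2 : y1 * (x * w * x⁻¹) * y1⁻¹ = y1 * x * w * (y1 * x)⁻¹ := by group
      rw [h2] at h1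
      exact hP1.le h1
    · intro w hw
      have h1 := hc2 _ (conj_mem (le_normalizer_pp Z s (inv_mem hz)) (hLZ hw))
      have h2 : y2 * (z⁻¹ * w * z⁻¹⁻¹) * y2⁻¹ = y1 * x * w * (y1 * x)⁻¹ := by rw [hy]; group
      rw [h2] at h1
      exact hS1.le h1
  have hyY : y1 * x ∈ Y := mul_mem hy1 hx.2
  have hJT : J ≤ T := by
    intro w hw
    have h1 : (y1 * x)⁻¹ * w * (y1 * x) ∈ J := by simpa using conj_mem (inv_mem hyY) hw
    have h2 : (y1 * x) * ((y1 * x)⁻¹ * w * (y1 * x)) * (y1 * x)⁻¹ ∈ T := hJc h1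
    simpa [mul_assoc] using h2
  have hJs : Group.IsSolvable J := solv_mono hJY hsol
  haveI : Nontrivial J := (nontrivial_iff_ne_bot J).2 hJ1
  obtain ⟨l, hl, N, hN, hNb, hNp⟩ := exists_normal_pgroup hJs
  haveI := Fact.mk hl
  have hNJ : N.map J.subtype ≤ pp J l := by
    apply le_pp
    · rintro _ ⟨x, -, rfl⟩; exact x.2
    · exact hNp.map _
    · intro g hg
      apply mem_norm_of_conj
      rintro _ ⟨x, hx, rfl⟩
      exact ⟨⟨g, hg⟩ * x * ⟨g, hg⟩⁻¹, hN.conj_mem x hx _, rfl⟩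
  have hE : pp J l ≠ ⊥ := by
    intro h
    rw [h, le_bot_iff] at hNJ
    exact hNb ((map_eq_bot_iff_of_injective N J.subtype_injective).1 hNJ)
  have hlJ : l ∣ Nat.card J := by
    obtain ⟨x, hx, hx1⟩ := exists_ne_one hE
    exact dvd_card_of_mem (pp_le J l hx) hx1 (isPGroup_iff_mem.1 (pp_isPGroup J l) x hx)
  have hEY : Y ≤ normalizer (pp J l : Set G) := normalizer_le_normalizer_pp J l
  refine ⟨pp J l, hE, hJY.trans hEY, ?_⟩
  rcases hT1 l hl (hlJ.trans (card_dvd_of_le hJT)) with rfl | rfl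
  · left
    exact (sX.normal_le ((pp_le J l).trans hJY) (pp_isPGroup J l) hEY).trans
      (le_pp_of_isPGroup c.nA ((pp_le X l).trans inf_le_left) (pp_isPGroup X l))
  · right
    exact (sZ.normal_le ((pp_le J l).trans hJY) (pp_isPGroup J l) hEY).trans
      (le_pp_of_isPGroup c.nB ((pp_le Z l).trans inf_le_left) (pp_isPGroup Z l))

end Ctx
end fac
end KW

namespace KW

open Subgroup

set_option linter.unusedSectionVars false
set_option linter.style.haveILetI false

section fac
variable {G : Type*} [Group G] [Finite G] {A B : Subgroup G}

theorem norm_of_pp (nA : Group.IsNilpotent A) {q : ℕ} [hq : Fact q.Prime] {E : Subgroup G}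
    (hE : E ≤ pp A q) (hn : pp A q ≤ normalizer (E : Set G)) : A ≤ normalizer (E : Set G) := by
  apply le_of_pp_le nA
  intro r hr _
  haveI := Fact.mk hr
  by_cases h : r = q
  · subst h; exact hn
  · intro x hx
    apply mem_norm_of_conj
    intro y hy
    rw [pp_comm h hx (hE hy)]
    simpa using hy

theorem mem_cent {x y : G} : x ∈ centralizer ({y} : Set G) ↔ x * y = y * x :=
  mem_centralizer_singleton_iff

namespace Ctx

theorem J1half (c : Ctx A B) {q s : ℕ} [hq : Fact q.Prime] [hs : Fact s.Prime]
    (hsB : s ∣ Nat.card B) {E : Subgroup G} (hE1 : E ≠ ⊥) (hE : E ≤ pp A q)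
    (hA : pp A q ≤ normalizer (E : Set G)) (hB : pp B s ≤ normalizer (E : Set G)) : False := by
  obtain ⟨z, hz, hz1, hzc⟩ := c.symm.cenA hsB
  exact hz1 (c.L1 (norm_of_pp c.nA hE hA)
    (c.normalizer_ne_top hE1 (c.ne_top_of_le (hE.trans (pp_le A q)))) (hB hz) hzc)

theorem J1 (c : Ctx A B) {q s : ℕ} [hq : Fact q.Prime] [hs : Fact s.Prime]
    (hqA : q ∣ Nat.card A) (hsB : s ∣ Nat.card B) : pp A q ⊔ pp B s = ⊤ := by
  by_contra hne
  obtain ⟨E, hE1, hEn, hE⟩ := c.JG hqA hsB le_rfl (le_normalizer_pp A q) (pp_ne_bot c.nA hqA)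
    le_rfl (le_normalizer_pp B s) hne
  rcases hE with hE | hE
  · exact c.J1half hsB hE1 hE (le_sup_left.trans hEn) (le_sup_right.trans hEn)
  · exact c.symm.J1half hqA hE1 hE (le_sup_right.trans hEn) (le_sup_left.trans hEn)

theorem J1' (c : Ctx A B) {p s : ℕ} [hp : Fact p.Prime] [hs : Fact s.Prime]
    (hpA : p ∣ Nat.card A) (hsB : s ∣ Nat.card B) {z : G} (hz : z ∈ pp A p) (hz1 : z ≠ 1)
    (hzc : ∀ a ∈ A, a * z = z * a) : zpowers z ⊔ pp B s = ⊤ := by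
  by_contra hne
  have hcen : ∀ a ∈ A, ∀ x ∈ zpowers z, a * x = x * a := by
    rintro a ha _ ⟨n, rfl⟩
    have h1 : Commute a z := hzc a ha
    exact h1.zpow_right n
  obtain ⟨E, hE1, hEn, hE⟩ := c.JG hpA hsB (K := zpowers z) (by simpa using hz) (by
      intro a ha
      apply mem_norm_of_conj
      intro x hx
      rw [hcen a ha x hx]; simpa using hx) (by simpa using hz1)
    le_rfl (le_normalizer_pp B s) hne
  rcases hE with hE | hE
  · obtain ⟨q, hq, hqp, hqA⟩ := c.twoA p
    haveI := Fact.mk hq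
    apply c.normalizer_ne_top hE1 (c.ne_top_of_le (hE.trans (pp_le A p)))
    rw [← top_le_iff, ← c.J1 hqA hsB]
    apply sup_le _ (le_sup_right.trans hEn)
    intro x hx
    apply mem_norm_of_conj
    intro y hy
    rw [pp_comm hqp hx (hE hy)]
    simpa using hy
  · apply hz1
    apply c.symm.L1 (M := normalizer (E : Set G)) (norm_of_pp c.nB hE (le_sup_right.trans hEn))
      (c.normalizer_ne_top hE1 (c.symm.ne_top_of_le (hE.trans (pp_le B s)))) _ hzc
    exact hEn (mem_sup_left (mem_zpowers z))

theorem J2 (c : Ctx A B) {p : ℕ} [hp : Fact p.Prime]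
    (hpA : p ∣ Nat.card A) {z : G} (hz : z ∈ pp A p) (hz1 : z ≠ 1)
    (hzc : ∀ a ∈ A, a * z = z * a) {g : G} (hg : g * z = z * g) : g ∈ A := by
  have hD : centralizer ({z} : Set G) ⊓ B = ⊥ := by
    by_contra hD
    have hcard : Nat.card (centralizer ({z} : Set G) ⊓ B : Subgroup G) ≠ 1 :=
      fun h => hD (card_eq_one.1 h)
    obtain ⟨r, hr, hd⟩ := Nat.exists_prime_and_dvd hcard
    haveI := Fact.mk hr
    obtain ⟨v, hv, hvo⟩ := exists_mem_orderOf hd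
    have hvB : v ∈ pp B r := mem_pp c.nB hv.2 ⟨1, by rw [pow_one, ← hvo]; exact pow_orderOf_eq_one v⟩
    obtain ⟨s, hs, hsr, hsB⟩ := c.twoB r
    haveI := Fact.mk hs
    have ht : (⊤ : Subgroup G) ≤ centralizer ({v} : Set G) := by
      rw [← c.J1' hpA hsB hz hz1 hzc]
      apply sup_le
      · rw [zpowers_le, mem_cent]
        exact (mem_cent.1 hv.1).symm
      · intro x hx
        rw [mem_cent]
        exact pp_comm hsr hx hvB
    have hv1 : v = 1 := c.cen v fun g => mem_cent.1 (ht (mem_top g))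
    rw [hv1, orderOf_one] at hvo
    exact hr.one_lt.ne hvo
  obtain ⟨a, ha, b, hb, hbM, rfl⟩ := c.dede c.prod (M := centralizer ({z} : Set G))
    (fun a ha => mem_cent.2 (hzc a ha)) (mem_cent.2 hg)
  have : b ∈ centralizer ({z} : Set G) ⊓ B := ⟨hbM, hb⟩
  rw [hD, mem_bot] at this
  rw [this, mul_one]; exact ha

theorem Na (c : Ctx A B) {l q : ℕ} [hl : Fact l.Prime] [hq : Fact q.Prime] (hlA : l ∣ Nat.card A)
    (hlq : l ≠ q) {E : Subgroup G} (hE1 : E ≠ ⊥) (hE : E ≤ pp A l)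
    (hn : A ≤ normalizer (E : Set G)) : normalizer (E : Set G) ≤ normalizer (pp A q : Set G) := by
  obtain ⟨z, hz, hz1, hzc⟩ := exists_central c.nA hE hE1 ((pp_le A l).trans hn)
  intro g hg
  apply mem_norm_of_conj
  intro x hx
  have h1 : g⁻¹ * z * g ∈ E := by simpa using conj_mem (inv_mem hg) hz
  have h2 := pp_comm hlq (hE h1) hx
  apply mem_pp c.nA
  · apply c.J2 hlA (hE hz) hz1 hzc
    calc g * x * g⁻¹ * z = g * (x * (g⁻¹ * z * g)) * g⁻¹ := by group
      _ = g * ((g⁻¹ * z * g) * x) * g⁻¹ := by rw [h2]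
      _ = _ := by group
  · obtain ⟨k, hk⟩ := isPGroup_iff_mem.1 (pp_isPGroup A q) x hx
    exact ⟨k, by rw [conj_pow, hk]; group⟩

theorem N (c : Ctx A B) {l : ℕ} [hl : Fact l.Prime] (hlA : l ∣ Nat.card A)
    {E : Subgroup G} (hE1 : E ≠ ⊥) (hE : E ≤ pp A l)
    (hn : A ≤ normalizer (E : Set G)) : normalizer (E : Set G) ≤ normalizer (A : Set G) := by
  intro g hg
  have key : ∀ r : ℕ, r.Prime → r ∣ Nat.card A → g ∈ normalizer (pp A r : Set G) := by
    intro r hr _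
    haveI := Fact.mk hr
    by_cases h : l = r
    · subst h
      obtain ⟨q, hq, hql, hqA⟩ := c.twoA l
      haveI := Fact.mk hq
      exact c.Na hqA hql (pp_ne_bot c.nA hqA) le_rfl (le_normalizer_pp A q)
        (c.Na hlA (Ne.symm hql) hE1 hE hn hg)
    · exact c.Na hlA h hE1 hE hn hg
  apply mem_norm_of_conj
  have : A ≤ A.comap (MulAut.conj g).toMonoidHom := by
    apply le_of_pp_le c.nA
    intro r hr hrA x hx
    exact pp_le A r (conj_mem (key r hr hrA) hx)
  intro x hx
  exact this hx

theorem Npp (c : Ctx A B) {l : ℕ} [hl : Fact l.Prime] (hlA : l ∣ Nat.card A) :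
    normalizer (pp A l : Set G) ≤ normalizer (A : Set G) :=
  c.N hlA (pp_ne_bot c.nA hlA) le_rfl (le_normalizer_pp A l)

theorem A_ne_bot (c : Ctx A B) : A ≠ ⊥ := by
  intro h
  obtain ⟨q, hq, -, hqA⟩ := c.twoA 0
  rw [h, card_bot] at hqA
  exact hq.one_lt.ne' (Nat.dvd_one.1 hqA)

theorem M0_ne_top (c : Ctx A B) : normalizer (A : Set G) ≠ ⊤ :=
  c.normalizer_ne_top c.A_ne_bot c.A_ne_top

/-- `N_G(A) = A N_B(A)` -/
theorem M0_prod (c : Ctx A B) : ∀ h ∈ normalizer (A : Set G),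
    ∃ x ∈ A, ∃ z ∈ B ⊓ normalizer (A : Set G), h = x * z := by
  intro h hh
  obtain ⟨a, ha, b, hb, hbM, e⟩ := c.dede c.prod le_normalizer hh
  exact ⟨a, ha, b, ⟨hb, hbM⟩, e⟩

theorem M0_cop (c : Ctx A B) :
    Nat.Coprime (Nat.card A) (Nat.card (B ⊓ normalizer (A : Set G) : Subgroup G)) :=
  Nat.Coprime.of_dvd_right (card_dvd_of_le inf_le_left) c.cop

theorem LN0 (c : Ctx A B) {q s : ℕ} [hq : Fact q.Prime] [hs : Fact s.Prime]
    (hqA : q ∣ Nat.card A) (hsB : s ∣ Nat.card B) {D : Subgroup G} (hD1 : D ≠ ⊥)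
    (hD : D ≤ pp B s) (hn : pp A q ≤ normalizer (D : Set G)) : False := by
  set C := centralizer (D : Set G) with hC
  set W := normalizer (D : Set G) with hW
  have hCW : C ≤ W := by
    intro x hx
    apply mem_norm_of_conj
    intro y hy
    rw [← mem_centralizer_iff.1 hx y hy]; simpa using hy
  have hCn : W ≤ normalizer (C : Set G) := by
    intro w hw
    apply mem_norm_of_conj
    intro x hx
    rw [hC, mem_centralizer_iff]
    intro y hy
    have h1 : w⁻¹ * y * w ∈ D := by simpa using conj_mem (inv_mem hw) hy
    have h2 := mem_centralizer_iff.1 hx _ h1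
    calc y * (w * x * w⁻¹) = w * ((w⁻¹ * y * w) * x) * w⁻¹ := by group
      _ = w * (x * (w⁻¹ * y * w)) * w⁻¹ := by rw [h2]
      _ = _ := by group
  have hQC : pp A q ⊓ C = ⊥ := by
    by_contra hne
    obtain ⟨z, hz, hz1, hzc⟩ := exists_central c.nA (E := pp A q ⊓ C) inf_le_left hne (by
      intro g hg
      apply mem_norm_of_conj
      intro x hx
      exact ⟨conj_mem (le_normalizer hg) hx.1, conj_mem (hCn (hn hg)) hx.2⟩)
    obtain ⟨d, hd, hd1⟩ := exists_ne_one hD1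
    have h1 := mem_centralizer_iff.1 hz.2 d hd
    exact hd1 (c.disj (c.J2 hqA hz.1 hz1 hzc h1) (pp_le B s (hD hd)))
  have sQ : IsSyl q (pp A q) W := c.syl hqA hn
  have hqC : ¬ q ∣ Nat.card C := by
    intro hd
    obtain ⟨x, hx, hxo⟩ := exists_mem_orderOf hd
    obtain ⟨w, hw, hwc⟩ := sQ.conj_le (Q := zpowers x) (by simpa using hCW hx)
      (isPGroup_zpowers ⟨1, by rw [pow_one, ← hxo]; exact pow_orderOf_eq_one x⟩)
    have h1 : w * x * w⁻¹ ∈ pp A q ⊓ C := ⟨hwc x (mem_zpowers x), conj_mem (hCn hw) hx⟩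
    rw [hQC, mem_bot] at h1
    have : x = 1 := by simpa using h1
    rw [this, orderOf_one] at hxo
    exact hq.out.one_lt.ne hxo
  obtain ⟨s1, hs1, hss, hs1B⟩ := c.twoB s
  haveI := Fact.mk hs1
  have hSC : pp B s1 ≤ C := by
    intro x hx
    rw [hC, mem_centralizer_iff]
    intro y hy
    exact (pp_comm hss hx (hD hy)).symm
  have sS : IsSyl s1 (pp B s1) C := c.symm.syl hs1B hSC
  set U := W ⊓ normalizer (pp B s1 : Set G) with hU
  have hfr : ∀ w ∈ W, ∃ x ∈ C, ∃ u ∈ U, w = x * u := by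
    intro w hw
    obtain ⟨h, hh, hc⟩ := sS.conj_le (Q := (pp B s1).map (MulAut.conj w).toMonoidHom) (by
        rintro _ ⟨x, hx, rfl⟩
        exact conj_mem (hCn hw) (hSC hx)) ((pp_isPGroup B s1).map _)
    refine ⟨h⁻¹, inv_mem hh, h * w, ⟨mul_mem (hCW hh) hw, ?_⟩, by group⟩
    apply mem_norm_of_conj
    intro x hx
    have := hc (w * x * w⁻¹) ⟨x, hx, rfl⟩
    have e : h * (w * x * w⁻¹) * h⁻¹ = h * w * x * (h * w)⁻¹ := by group
    rwa [e] at this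
  have hnC : (C.subgroupOf W).Normal := (normal_subgroupOf_iff_le_normalizer hCW).2 hCn
  have hdvd : C.relIndex W ∣ Nat.card U := by
    have := card_dvd_of_surjective
      ((QuotientGroup.mk' (C.subgroupOf W)).comp (inclusion (inf_le_left : U ≤ W))) (by
        intro y
        obtain ⟨⟨w, hw⟩, rfl⟩ := QuotientGroup.mk'_surjective _ y
        obtain ⟨x, hx, u, hu, e⟩ := hfr w hw
        refine ⟨⟨u, hu⟩, ?_⟩
        change QuotientGroup.mk (s := C.subgroupOf W) (⟨u, hu.1⟩ : W) = QuotientGroup.mk ⟨w, hw⟩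
        rw [QuotientGroup.eq, mem_subgroupOf]
        change u⁻¹ * w ∈ C
        rw [e]
        have := conj_mem (hCn (inv_mem hu.1)) hx
        simpa [mul_assoc] using this)
    exact this
  have hcW : Nat.card C * C.relIndex W = Nat.card W := by
    have := relIndex_mul_relIndex ⊥ C W bot_le hCW
    simpa using this
  have hQU : Nat.card (pp A q) ∣ Nat.card U := by
    refine dvd_trans ?_ hdvd
    have h1 : Nat.card (pp A q) ∣ Nat.card C * C.relIndex W := by
      rw [hcW]; exact card_dvd_of_le hn
    refine Nat.Coprime.dvd_of_dvd_mul_left ?_ h1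
    rw [pp_card c.nA]
    exact Nat.Coprime.pow_left _ ((Nat.Prime.coprime_iff_not_dvd hq.out).2 hqC)
  have hUN : U ≤ normalizer (B : Set G) := inf_le_right.trans (c.symm.Npp hs1B)
  have hQN := hQU.trans (card_dvd_of_le hUN)
  set α := A ⊓ normalizer (B : Set G) with hα
  have hqB : ¬ q ∣ Nat.card B := c.not_dvd hq.out hqA
  have sα : IsSyl q (pp α q) (normalizer (B : Set G)) :=
    sylX inf_le_right le_normalizer c.symm.M0_cop.symm (prod_symm c.symm.M0_prod)
      (nilp_mono inf_le_left c.nA) hqB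
  have hle : pp α q ≤ pp A q := le_pp_of_isPGroup c.nA ((pp_le α q).trans inf_le_left)
    (pp_isPGroup α q)
  have heq : pp α q = pp A q := by
    apply eq_of_le_of_card_ge hle
    rw [sα.card]
    apply Nat.le_of_dvd (pow_pos hq.out.pos _)
    rw [pp_card c.nA] at hQN ⊢
    apply pow_dvd_pow
    exact (hq.out.pow_dvd_iff_le_factorization Nat.card_pos.ne').1 hQN
  obtain ⟨z, hz, hz1, hzc⟩ := c.cenA hqA
  rw [← heq] at hz
  exact hz1 (c.symm.L1 le_normalizer c.symm.M0_ne_top (pp_le α q hz).2 hzc)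

theorem LN (c : Ctx A B) {q s : ℕ} [hq : Fact q.Prime] [hs : Fact s.Prime]
    (hqA : q ∣ Nat.card A) (hsB : s ∣ Nat.card B) {D : Subgroup G} (hD1 : D ≠ ⊥)
    (hD : IsPGroup s D) (hn : pp A q ≤ normalizer (D : Set G)) : False := by
  obtain ⟨g, -, hg⟩ := (c.symm.sylTop hsB).conj_le (le_top) hD
  obtain ⟨b, hb, a, ha, rfl⟩ := c.prod' g
  apply c.LN0 hqA hsB (D := D.map (MulAut.conj a).toMonoidHom)
  · intro h
    exact hD1 ((map_eq_bot_iff_of_injective D (MulAut.conj a).injective).1 h)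
  · rintro _ ⟨x, hx, rfl⟩
    have h1 := conj_mem (le_normalizer_pp B s (inv_mem hb)) (hg x hx)
    have h2 : b⁻¹ * (b * a * x * (b * a)⁻¹) * b⁻¹⁻¹ = a * x * a⁻¹ := by group
    rw [h2] at h1
    exact h1
  · intro y hy
    apply mem_norm_of_conj
    rintro _ ⟨x, hx, rfl⟩
    have h1 : a⁻¹ * y * a ∈ pp A q := by
      simpa using conj_mem (le_normalizer_pp A q (inv_mem ha)) hy
    refine ⟨_, conj_mem (hn h1) hx, ?_⟩
    change a * (a⁻¹ * y * a * x * (a⁻¹ * y * a)⁻¹) * a⁻¹ = y * (a * x * a⁻¹) * y⁻¹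
    group

theorem S (c : Ctx A B) {p : ℕ} [hp : Fact p.Prime] (hpA : p ∣ Nat.card A) {u : G}
    (hu : u ∈ pp A p) (hu1 : u ≠ 1) {V : Subgroup G} (hV : V ≤ centralizer ({u} : Set G))
    (nV : Group.IsNilpotent V) (hcop : Nat.Coprime (Nat.card A) (Nat.card V))
    (hpr : ∀ h ∈ centralizer ({u} : Set G), ∃ x ∈ A ⊓ centralizer ({u} : Set G), ∃ z ∈ V,
      h = x * z) : centralizer ({u} : Set G) ≤ normalizer (A : Set G) := by
  set H := centralizer ({u} : Set G) with hH
  set X := A ⊓ H with hX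
  have nX : Group.IsNilpotent X := nilp_mono inf_le_left c.nA
  have hXV : Nat.Coprime (Nat.card X) (Nat.card V) :=
    Nat.Coprime.of_dvd_left (card_dvd_of_le inf_le_left) hcop
  have hHt : H ≠ ⊤ := by
    intro h
    apply hu1
    apply c.cen
    intro g
    have : g ∈ H := h ▸ mem_top g
    exact mem_cent.1 this
  have hsol : Group.IsSolvable H := c.ih H hHt X V inf_le_right hV nX nV hXV hpr
  have hq : ∀ q : ℕ, q.Prime → q ≠ p → pp A q ≤ H := by
    intro q hq hqp x hx
    haveI := Fact.mk hq
    rw [hH, mem_cent]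
    exact pp_comm hqp hx hu
  have hpV : ¬ p ∣ Nat.card V := fun h =>
    hp.out.one_lt.ne' (Nat.eq_one_of_dvd_coprimes hcop hpA h)
  have sX : IsSyl p (pp X p) H := sylX inf_le_right hV hXV hpr nX hpV
  obtain ⟨q, hqP, hqp, hqA⟩ := c.twoA p
  haveI := Fact.mk hqP
  have hex : ∃ l, l.Prime ∧ l ≠ p ∧ ∃ N : Subgroup H, N.Normal ∧ IsPGroup l N ∧ N ≠ ⊥ := by
    by_contra hno
    push Not at hno
    have hC := lemmaC hsol (p := p) (fun l hl hlp N hN hNp => hno l hl hlp N hN hNp)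
    obtain ⟨z, hz, hz1, -⟩ := c.cenA hqA
    apply hz1
    apply disj_of_pgroups hqp (isPGroup_iff_mem.1 (pp_isPGroup A q) z hz)
    have hzH := hq q hqP hqp hz
    have hzC : (⟨z, hzH⟩ : H) ∈ centralizer (pp (⊤ : Subgroup H) p : Set H) := by
      rw [mem_centralizer_iff]
      intro y hy
      apply Subtype.ext
      have hle : (pp (⊤ : Subgroup H) p).map H.subtype ≤ pp X p := by
        apply sX.normal_le
        · rintro _ ⟨x, -, rfl⟩; exact x.2
        · exact (pp_isPGroup _ p).map _
        · intro g hg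
          apply mem_norm_of_conj
          rintro _ ⟨x, hx, rfl⟩
          exact ⟨⟨g, hg⟩ * x * ⟨g, hg⟩⁻¹, conj_mem (le_normalizer_pp ⊤ p (mem_top _)) hx, rfl⟩
      have h1 : (y : G) ∈ pp X p := hle ⟨y, hy, rfl⟩
      have h2 : (y : G) ∈ pp A p := le_pp_of_isPGroup c.nA ((pp_le X p).trans inf_le_left)
        (pp_isPGroup X p) h1
      exact pp_comm (Ne.symm hqp) h2 hz
    obtain ⟨k, hk⟩ := isPGroup_iff_mem.1 hC _ hzC
    exact ⟨k, by simpa using congrArg Subtype.val hk⟩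
  obtain ⟨l, hl, hlp, N, hN, hNp, hNb⟩ := hex
  haveI := Fact.mk hl
  set E := N.map H.subtype with hE
  have hE1 : E ≠ ⊥ := fun h => hNb ((map_eq_bot_iff_of_injective N H.subtype_injective).1 h)
  have hEp : IsPGroup l E := hNp.map _
  have hEH : E ≤ H := by rintro _ ⟨x, -, rfl⟩; exact x.2
  have hEn : H ≤ normalizer (E : Set G) := by
    intro g hg
    apply mem_norm_of_conj
    rintro _ ⟨x, hx, rfl⟩
    exact ⟨⟨g, hg⟩ * x * ⟨g, hg⟩⁻¹, hN.conj_mem x hx _, rfl⟩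
  by_cases hlA : l ∣ Nat.card A
  · have hle : pp A l ≤ H := hq l hl hlp
    have hEA : E ≤ pp A l := (c.syl hlA hle).normal_le hEH hEp hEn
    exact hEn.trans (c.N hlA hE1 hEA (norm_of_pp c.nA hEA (hle.trans hEn)))
  · exfalso
    obtain ⟨x, hx, hx1⟩ := exists_ne_one hE1
    have h1 : l ∣ Nat.card (⊤ : Subgroup G) :=
      dvd_card_of_mem (mem_top x) hx1 (isPGroup_iff_mem.1 hEp x hx)
    rw [card_prod (le_top : A ≤ ⊤) (le_top : B ≤ ⊤) c.cop (fun g _ => c.prod g), hl.dvd_mul] at h1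
    exact c.LN hqA (h1.resolve_left hlA) hE1 hEp ((hq q hqP hqp).trans hEn)

theorem fusion (c : Ctx A B) {p : ℕ} [hp : Fact p.Prime] {u g : G}
    (hu : u ∈ pp A p) (hg : g * u * g⁻¹ ∈ pp A p) :
    ∃ m ∈ normalizer (A : Set G), ∃ k, k * u = u * k ∧ g = m * k := by
  obtain ⟨q, hqP, hqp, hqA⟩ := c.twoA p
  haveI := Fact.mk hqP
  have hle : pp A q ≤ centralizer ({u} : Set G) := by
    intro x hx; rw [mem_cent]; exact pp_comm hqp hx hu
  obtain ⟨h, hh, hc⟩ := (c.syl hqA hle).conj_le (Q := (pp A q).map (MulAut.conj g⁻¹).toMonoidHom)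
    (by
      rintro _ ⟨x, hx, rfl⟩
      have h1 := pp_comm hqp hx hg
      change g⁻¹ * x * g⁻¹⁻¹ ∈ centralizer ({u} : Set G)
      rw [mem_cent]
      calc g⁻¹ * x * g⁻¹⁻¹ * u = g⁻¹ * (x * (g * u * g⁻¹)) * g := by group
        _ = g⁻¹ * ((g * u * g⁻¹) * x) * g := by rw [h1]
        _ = _ := by group) ((pp_isPGroup A q).map _)
  have hm : h * g⁻¹ ∈ normalizer (pp A q : Set G) := by
    apply mem_norm_of_conj
    intro x hx
    have h1 := hc _ ⟨x, hx, rfl⟩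
    change h * (g⁻¹ * x * g⁻¹⁻¹) * h⁻¹ ∈ _ at h1
    have e : h * (g⁻¹ * x * g⁻¹⁻¹) * h⁻¹ = h * g⁻¹ * x * (h * g⁻¹)⁻¹ := by group
    rwa [e] at h1
  exact ⟨(h * g⁻¹)⁻¹, inv_mem (c.Npp hqA hm), h, mem_cent.1 hh, by group⟩

end Ctx
end fac
end KW

namespace KW

open Subgroup
open scoped commutatorElement

set_option linter.unusedSectionVars false
set_option linter.style.haveILetI false

section fin
variable {G : Type*} [Group G] [Finite G] {A B : Subgroup G}

/-- elements inducing on `P` an inner automorphism of `P` -/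
def innerOn (P : Subgroup G) : Subgroup G where
  carrier := {m | ∃ m' ∈ P, ∀ x ∈ P, m * x * m⁻¹ = m' * x * m'⁻¹}
  one_mem' := ⟨1, one_mem _, fun x _ => rfl⟩
  mul_mem' := by
    rintro m n ⟨m', hm', hm⟩ ⟨n', hn', hn⟩
    refine ⟨m' * n', mul_mem hm' hn', fun x hx => ?_⟩
    have h1 := hm (n' * x * n'⁻¹) (mul_mem (mul_mem hn' hx) (inv_mem hn'))
    rw [← hn x hx] at h1
    have h2 : m * n * x * (m * n)⁻¹ = m * (n * x * n⁻¹) * m⁻¹ := by group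
    rw [h2, h1, hn x hx]; group
  inv_mem' := by
    rintro m ⟨m', hm', hm⟩
    refine ⟨m'⁻¹, inv_mem hm', fun x hx => ?_⟩
    have h1 := hm (m'⁻¹ * x * m') (mul_mem (mul_mem (inv_mem hm') hx) hm')
    have h2 : m' * (m'⁻¹ * x * m') * m'⁻¹ = x := by group
    rw [h2] at h1
    conv_lhs => rw [← h1]
    group

theorem le_innerOn (nA : Group.IsNilpotent A) {p : ℕ} [hp : Fact p.Prime] :
    A ≤ innerOn (pp A p) := by
  apply le_of_pp_le nA
  intro q hq _ x hx
  haveI := Fact.mk hq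
  by_cases h : q = p
  · subst h; exact ⟨x, hx, fun _ _ => rfl⟩
  · refine ⟨1, one_mem _, fun y hy => ?_⟩
    rw [pp_comm h hx hy]; group

namespace Ctx

theorem perfect (c : Ctx A B) : commutator G = ⊤ := by
  rcases c.simple (commutator G) inferInstance with h | h
  · exfalso
    have h1 : ∀ x y : G, x * y = y * x := by
      intro x y
      have : ⁅x, y⁆ ∈ commutator G := commutator_mem_commutator (mem_top x) (mem_top y)
      rw [h, mem_bot] at this
      exact commutatorElement_eq_one_iff_mul_comm.1 this
    obtain ⟨x, -, hx⟩ := exists_ne_one c.A_ne_bot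
    exact hx (c.cen x fun g => h1 g x)
  · exact h

theorem T (c : Ctx A B) : ∃ b ∈ B, b ∈ normalizer (A : Set G) ∧ b ≠ 1 := by
  by_contra hcon
  push Not at hcon
  have hNA : normalizer (A : Set G) ≤ A := by
    intro m hm
    obtain ⟨a, ha, b, hb, e⟩ := c.M0_prod m hm
    rw [e, hcon b hb.1 hb.2, mul_one]; exact ha
  obtain ⟨p, hp, -, hpA⟩ := c.twoA 0
  haveI := Fact.mk hp
  have hsyl := c.sylTop hpA
  have hidx : ¬ p ∣ (pp A p).index := by have := hsyl.ndvd; rwa [relIndex_top_right] at this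
  have hfoc := commutator_inf_eq_focalSubgroup (hsyl.pg.toSylow hidx)
  rw [c.perfect, top_inf_eq, IsPGroup.toSylow_coe] at hfoc
  have hle : (pp A p) ≤ ⁅pp A p, pp A p⁆ := by
    conv_lhs => rw [hfoc]
    rw [focalSubgroup, closure_le]
    rintro g ⟨hg, x, hx, u, rfl⟩
    have h1 : u * x⁻¹ * u⁻¹ ∈ pp A p := by
      have := mul_mem (inv_mem hx) hg
      rw [commutatorElement_def] at this
      simpa [mul_assoc] using this
    obtain ⟨m, hm, k, hk, rfl⟩ := c.fusion (inv_mem hx) h1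
    obtain ⟨m', hm', hmm⟩ := le_innerOn (p := p) c.nA (hNA hm)
    have h2 : ⁅x, m * k⁆ = ⁅x, m'⁆ := by
      have h3 : m * k * x⁻¹ * (m * k)⁻¹ = m * x⁻¹ * m⁻¹ := by
        rw [mul_assoc m k, hk]; group
      have h4 : ⁅x, m * k⁆ = x * (m * k * x⁻¹ * (m * k)⁻¹) := by
        rw [commutatorElement_def]; group
      rw [h4, h3, hmm _ (inv_mem hx), commutatorElement_def]; group
    rw [h2]
    exact commutator_mem_commutator hx hm'
  have hne := pp_ne_bot c.nA hpA
  haveI : Nontrivial (pp A p) := (nontrivial_iff_ne_bot _).2 hne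
  haveI : Group.IsNilpotent (pp A p) := nilp_mono (pp_le A p) c.nA
  have hlt := Group.IsSolvable.commutator_lt_top_of_nontrivial (pp A p)
  apply hlt.ne
  rw [← map_subtype_commutator] at hle
  rw [eq_top_iff]
  intro x _
  obtain ⟨y, hy, e⟩ := hle x.2
  have : y = x := Subtype.ext e
  rwa [← this]

theorem Ca (c : Ctx A B) {x : G} (hxA : x ∈ A) (hxB : x ∈ normalizer (B : Set G)) {g : G}
    (hg : g ∈ centralizer ({x} : Set G)) : ∃ a ∈ A ⊓ centralizer ({x} : Set G),
      ∃ b ∈ B ⊓ centralizer ({x} : Set G), g = a * b := by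
  obtain ⟨a, ha, b, hb, rfl⟩ := c.prod g
  rw [mem_cent] at hg
  have h1 : a⁻¹ * x * a * x⁻¹ = b * (x * b⁻¹ * x⁻¹) := by
    have : a⁻¹ * x * a = b * x * b⁻¹ := by
      rw [eq_mul_inv_iff_mul_eq, mul_assoc, mul_assoc, inv_mul_eq_iff_eq_mul, ← mul_assoc, ← mul_assoc]
      rw [mul_assoc x, hg]
    rw [this]; group
  have h2 : b * (x * b⁻¹ * x⁻¹) = 1 := by
    apply c.disj
    · rw [← h1]
      exact mul_mem (mul_mem (mul_mem (inv_mem ha) hxA) ha) (inv_mem hxA)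
    · exact mul_mem hb (conj_mem hxB (inv_mem hb))
  have h3 : b * x = x * b := by
    have : b * x * b⁻¹ * x⁻¹ = 1 := by rw [← h2]; group
    rw [mul_inv_eq_one, mul_inv_eq_iff_eq_mul] at this
    exact this
  refine ⟨a, ⟨ha, ?_⟩, b, ⟨hb, mem_cent.2 h3⟩, rfl⟩
  have : b ∈ centralizer ({x} : Set G) := mem_cent.2 h3
  have h5 : a * b * b⁻¹ ∈ centralizer ({x} : Set G) := mul_mem (mem_cent.2 hg) (inv_mem this)
  simpa using h5

theorem CaLe (c : Ctx A B) {p : ℕ} [hp : Fact p.Prime] {x : G} (hx : x ∈ pp A p) (hx1 : x ≠ 1)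
    (hxB : x ∈ normalizer (B : Set G)) : centralizer ({x} : Set G) ≤ normalizer (A : Set G) := by
  have hpA : p ∣ Nat.card A := dvd_card_of_mem (pp_le A p hx) hx1
    (isPGroup_iff_mem.1 (pp_isPGroup A p) x hx)
  refine c.S hpA hx hx1 (V := B ⊓ centralizer ({x} : Set G)) inf_le_right
    (nilp_mono inf_le_left c.nB) (c.cop.of_dvd_right (card_dvd_of_le inf_le_left)) ?_
  intro h hh
  exact c.Ca (pp_le A p hx) hxB hh

theorem T2 (c : Ctx A B) {p q : ℕ} [hp : Fact p.Prime] [hq : Fact q.Prime] (hpq : q ≠ p) {u x : G}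
    (hu : u ∈ pp A p) (hx : x ∈ pp A q) (hx1 : x ≠ 1) (hxB : x ∈ normalizer (B : Set G)) {g : G}
    (hg : g ∈ centralizer ({u} : Set G)) :
    ∃ m ∈ normalizer (A : Set G) ⊓ centralizer ({u} : Set G),
      ∃ b ∈ B ⊓ centralizer ({u} : Set G), g = m * b := by
  obtain ⟨a, ha, b, hb, rfl⟩ := c.prod g
  have hqA : q ∣ Nat.card A := dvd_card_of_mem (pp_le A q hx) hx1
    (isPGroup_iff_mem.1 (pp_isPGroup A q) x hx)
  have hg' := mem_cent.1 hg
  set B1 := B ⊓ centralizer ({u} : Set G) with hB1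
  have hxu : x * u = u * x := pp_comm hpq hx hu
  have h1 : b * u * b⁻¹ = a⁻¹ * u * a := by
    symm
    rw [eq_mul_inv_iff_mul_eq, mul_assoc, mul_assoc, inv_mul_eq_iff_eq_mul, ← mul_assoc, ← mul_assoc]
    rw [mul_assoc u, hg']
  have h2 : b * u * b⁻¹ ∈ pp A p := by
    rw [h1]
    simpa using conj_mem (inv_mem (le_normalizer_pp A p ha)) hu
  have h3 : x * (b * u * b⁻¹) = (b * u * b⁻¹) * x := pp_comm hpq hx h2
  -- `x` preserves the coset
  have hxu' : x ∈ centralizer ({u} : Set G) := mem_cent.2 hxu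
  have hbx : b⁻¹ * (x * b * x⁻¹) ∈ B1 := by
    refine ⟨B.mul_mem (B.inv_mem hb) (conj_mem hxB hb), ?_⟩
    have e : b⁻¹ * x * b ∈ centralizer ({u} : Set G) := by
      rw [mem_cent]
      calc b⁻¹ * x * b * u = b⁻¹ * (x * (b * u * b⁻¹)) * b := by group
        _ = b⁻¹ * ((b * u * b⁻¹) * x) * b := by rw [h3]
        _ = u * (b⁻¹ * x * b) := by group
    have := mul_mem e (Subgroup.inv_mem _ hxu')
    simpa [mul_assoc] using this
  have hinv : ∀ y, b⁻¹ * y ∈ B1 → b⁻¹ * (x * y * x⁻¹) ∈ B1 := by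
    intro y hy
    have e : b⁻¹ * (x * y * x⁻¹) = b⁻¹ * (x * b * x⁻¹) * (x * (b⁻¹ * y) * x⁻¹) := by group
    rw [e]
    refine mul_mem hbx ⟨conj_mem hxB hy.1, Subgroup.mul_mem _ (Subgroup.mul_mem _ hxu' hy.2) (Subgroup.inv_mem _ hxu')⟩
  have hinvn : ∀ n : ℕ, ∀ y, b⁻¹ * y ∈ B1 → b⁻¹ * (x ^ n * y * (x ^ n)⁻¹) ∈ B1 := by
    intro n
    induction n with
    | zero => intro y hy; simpa using hy
    | succ n ih =>
      intro y hy
      have := hinv _ (ih y hy)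
      have e : x * (x ^ n * y * (x ^ n)⁻¹) * x⁻¹ = x ^ (n+1) * y * (x ^ (n+1))⁻¹ := by
        rw [pow_succ']; group
      rwa [e] at this
  have hinvz : ∀ k : zpowers x, ∀ y, b⁻¹ * y ∈ B1 → b⁻¹ * ((k:G) * y * (k:G)⁻¹) ∈ B1 := by
    rintro ⟨k, hk⟩
    obtain ⟨n, rfl⟩ := mem_powers_iff_mem_zpowers.2 hk
    exact hinvn n
  letI act : MulAction (zpowers x) {y : G // b⁻¹ * y ∈ B1} :=
    { smul := fun k y => ⟨(k:G) * y.1 * (k:G)⁻¹, hinvz k y.1 y.2⟩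
      one_smul := fun y => Subtype.ext (by
        change ((1 : zpowers x) : G) * y.1 * ((1 : zpowers x) : G)⁻¹ = y.1
        simp)
      mul_smul := fun k l y => Subtype.ext (by
        change ((k * l : zpowers x) : G) * y.1 * ((k * l : zpowers x) : G)⁻¹ =
          (k : G) * ((l:G) * y.1 * (l:G)⁻¹) * (k:G)⁻¹
        push_cast; group) }
  have hcard : Nat.card {y : G // b⁻¹ * y ∈ B1} = Nat.card B1 :=
    Nat.card_congr
      { toFun := fun y => ⟨b⁻¹ * y.1, y.2⟩
        invFun := fun z => ⟨b * z.1, by simp⟩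
        left_inv := fun y => by simp
        right_inv := fun y => by simp }
  have hpg : IsPGroup q (zpowers x) :=
    isPGroup_zpowers (isPGroup_iff_mem.1 (pp_isPGroup A q) x hx)
  obtain ⟨⟨y, hy⟩, hfix⟩ := hpg.nonempty_fixed_point_of_prime_not_dvd_card
    {y : G // b⁻¹ * y ∈ B1} (by
      rw [hcard]
      intro h
      exact c.not_dvd hq.out hqA (h.trans (card_dvd_of_le inf_le_left)))
  have hxy : x * y * x⁻¹ = y := congrArg Subtype.val (hfix ⟨x, mem_zpowers x⟩)
  have hyM : y ∈ normalizer (A : Set G) := by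
    apply c.CaLe hx hx1 hxB
    rw [mem_cent]
    rw [mul_inv_eq_iff_eq_mul] at hxy
    exact hxy.symm
  have hyb : y⁻¹ * b ∈ B1 := by
    have := inv_mem hy
    simpa using this
  refine ⟨a * y, ⟨mul_mem (le_normalizer ha) hyM, ?_⟩, y⁻¹ * b, hyb, by group⟩
  have := mul_mem hg (inv_mem hyb.2)
  have e : a * b * (y⁻¹ * b)⁻¹ = a * y := by group
  rwa [e] at this

end Ctx
end fin
end KW

namespace KW

open Subgroup

set_option linter.unusedSectionVars false
set_option linter.style.haveILetI false

section fin2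
variable {G : Type*} [Group G] [Finite G] {A B : Subgroup G}

theorem pow_conj_pp {p : ℕ} {x g : G} (h : ∃ k : ℕ, x ^ p ^ k = 1) :
    ∃ k : ℕ, (g * x * g⁻¹) ^ p ^ k = 1 := by
  obtain ⟨k, hk⟩ := h
  exact ⟨k, by rw [conj_pow, hk]; group⟩

theorem pel {A : Subgroup G} {p : ℕ} {x : G} (h : x ∈ pp A p) : ∃ k : ℕ, x ^ p ^ k = 1 :=
  isPGroup_iff_mem.1 (pp_isPGroup A p) x h

theorem pel_of_order {p : ℕ} {x : G} (h : orderOf x = p) : ∃ k : ℕ, x ^ p ^ k = 1 :=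
  ⟨1, by rw [pow_one, ← h, pow_orderOf_eq_one]⟩

theorem conj_cent {x y g : G} (h : x * y = y * x) :
    (g * x * g⁻¹) * (g * y * g⁻¹) = (g * y * g⁻¹) * (g * x * g⁻¹) := by
  have e1 : (g * x * g⁻¹) * (g * y * g⁻¹) = g * (x * y) * g⁻¹ := by group
  have e2 : (g * y * g⁻¹) * (g * x * g⁻¹) = g * (y * x) * g⁻¹ := by group
  rw [e1, e2, h]

theorem pr_of_card {H X Z : Subgroup G} (hX : X ≤ H) (hZ : Z ≤ H)
    (cop : Nat.Coprime (Nat.card X) (Nat.card Z)) (hd : Nat.card H ∣ Nat.card X * Nat.card Z) :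
    ∀ h ∈ H, ∃ x ∈ X, ∃ z ∈ Z, h = x * z := by
  have hinj : Function.Injective
      (fun w : X × Z => (⟨w.1 * w.2, mul_mem (hX w.1.2) (hZ w.2.2)⟩ : H)) := by
    rintro ⟨⟨x, hx⟩, ⟨z, hz⟩⟩ ⟨⟨x', hx'⟩, ⟨z', hz'⟩⟩ h
    have h1 : x * z = x' * z' := congrArg Subtype.val h
    have h2 : x'⁻¹ * x = z' * z⁻¹ := by
      rw [inv_mul_eq_iff_eq_mul, ← mul_assoc, ← h1]; group
    have h3 : x'⁻¹ * x = 1 := disj_of_cop cop (mul_mem (inv_mem hx') hx)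
      (h2 ▸ mul_mem hz' (inv_mem hz))
    have h4 : z' * z⁻¹ = 1 := h2 ▸ h3
    have e1 : x = x' := (inv_mul_eq_one.1 h3).symm
    have e2 : z = z' := (mul_inv_eq_one.1 h4).symm
    subst e1; subst e2; rfl
  have hc : Nat.card (X × Z) = Nat.card H := by
    apply le_antisymm
    · exact Nat.card_le_card_of_injective _ hinj
    · rw [Nat.card_prod]
      exact Nat.le_of_dvd (Nat.mul_pos Nat.card_pos Nat.card_pos) hd
  have hbij := (Nat.bijective_iff_injective_and_card _).2 ⟨hinj, hc⟩
  intro h hh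
  obtain ⟨⟨x, z⟩, e⟩ := hbij.2 ⟨h, hh⟩
  exact ⟨x, x.2, z, z.2, (congrArg Subtype.val e).symm⟩

namespace Ctx

theorem cardG (c : Ctx A B) : Nat.card G = Nat.card A * Nat.card B := by
  rw [← card_prod (H := ⊤) le_top le_top c.cop (fun g _ => c.prod g), card_top]

theorem conjInto (c : Ctx A B) {p : ℕ} [hp : Fact p.Prime] (hpA : p ∣ Nat.card A) {y : G}
    (hy : y ∈ normalizer (B : Set G)) (hp' : ∃ k : ℕ, y ^ p ^ k = 1) :
    ∃ g : G, g * y * g⁻¹ ∈ A ∧ g * y * g⁻¹ ∈ normalizer (B : Set G) := by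
  have hs : IsSyl p (pp (A ⊓ normalizer (B : Set G)) p) (normalizer (B : Set G)) :=
    sylX (Z := B) inf_le_right le_normalizer c.symm.M0_cop.symm
      (prod_symm c.symm.M0_prod) (nilp_mono inf_le_left c.nA) (c.not_dvd hp.out hpA)
  obtain ⟨g, -, hg⟩ := hs.conj_le (Q := zpowers y) (by simpa using hy) (isPGroup_zpowers hp')
  exact ⟨g, pp_le _ p (hg y (mem_zpowers y))⟩

/-- not conjugate into `α` -/
def Bad (A B : Subgroup G) (u : G) : Prop :=
  ∀ g : G, g * u * g⁻¹ ∈ A → g * u * g⁻¹ ∈ normalizer (B : Set G) → False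

theorem Bad.conj {u : G} (h : Bad A B u) (g : G) : Bad A B (g * u * g⁻¹) := by
  intro k h1 h2
  have e : k * (g * u * g⁻¹) * k⁻¹ = (k * g) * u * (k * g)⁻¹ := by group
  rw [e] at h1 h2
  exact h _ h1 h2

theorem bad1 (c : Ctx A B) {p s : ℕ} [hp : Fact p.Prime] [hs : Fact s.Prime]
    (hpA : p ∣ Nat.card A) {u v : G} (hu : ∃ k : ℕ, u ^ p ^ k = 1) (hb : Bad A B u)
    (hv : v ∈ centralizer ({u} : Set G)) (hv1 : v ≠ 1) (hvs : ∃ k : ℕ, v ^ s ^ k = 1) :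
    Bad B A v := by
  intro h h1 h2
  have h3 : h * v * h⁻¹ ∈ pp B s := mem_pp c.nB h1 (pow_conj_pp hvs)
  have h4 := c.symm.CaLe h3 (by simpa using hv1) h2
  have h5 : h * u * h⁻¹ ∈ normalizer (B : Set G) :=
    h4 (mem_cent.2 (conj_cent (mem_cent.1 hv).symm))
  obtain ⟨g, hg1, hg2⟩ := c.conjInto hpA h5 (pow_conj_pp hu)
  exact hb.conj h g hg1 hg2

theorem le_A_of (c : Ctx A B) {H : Subgroup G} (hH : H ≤ normalizer (A : Set G))
    (h : ∀ s : ℕ, s.Prime → s ∣ Nat.card B → ∀ v ∈ H, orderOf v ≠ s) : H ≤ A := by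
  obtain hn := fun (r : ℕ) (hr : r.Prime) (hrA : r ∣ Nat.card A) =>
    (haveI := Fact.mk hr; c.syl hrA ((pp_le A r).trans (le_normalizer (H := A))))
  intro y hy
  have : zpowers y ≤ A := by
    have nz : Group.IsNilpotent (zpowers y) :=
      @CommGroup.isNilpotent _ (IsCyclic.commGroup (α := zpowers y))
    apply le_of_pp_le nz
    intro r hr hrd
    haveI := Fact.mk hr
    have hrA : r ∣ Nat.card A := by
      have h1 : r ∣ Nat.card G := hrd.trans (card_subgroup_dvd_card _)
      rw [c.cardG, hr.dvd_mul] at h1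
      rcases h1 with h1 | h1
      · exact h1
      · exfalso
        obtain ⟨v, hv, hvo⟩ := exists_mem_orderOf hrd
        exact h r hr h1 v ((zpowers_le.2 hy) hv) hvo
    obtain ⟨g, hg, hc⟩ := (hn r hr hrA).conj_le (Q := pp (zpowers y) r)
      ((pp_le _ r).trans ((zpowers_le.2 hy).trans hH)) (pp_isPGroup _ r)
    intro x hx
    have h1 := pp_le A r (hc x hx)
    have := conj_mem (inv_mem hg) h1
    simpa [mul_assoc] using this
  exact this (mem_zpowers y)

theorem step1 (c : Ctx A B) {p q : ℕ} [hp : Fact p.Prime] [hq : Fact q.Prime] (hpq : q ≠ p) {u x : G}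
    (hpA : p ∣ Nat.card A) (hu1 : u ≠ 1)
    (hu : u ∈ pp A p) (hx : x ∈ pp A q) (hx1 : x ≠ 1) (hxB : x ∈ normalizer (B : Set G))
    (hb : Bad A B u) : centralizer ({u} : Set G) ≤ A := by
  have hno : ∀ s : ℕ, s.Prime → s ∣ Nat.card B →
      ∀ v ∈ normalizer (A : Set G) ⊓ centralizer ({u} : Set G), orderOf v ≠ s := by
    intro s hs hsB v hv ho
    haveI := Fact.mk hs
    have hv1 : v ≠ 1 := by
      rintro rfl; rw [orderOf_one] at ho; exact hs.one_lt.ne ho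
    obtain ⟨g, h1, h2⟩ := c.symm.conjInto hsB hv.1 (pel_of_order ho)
    exact c.bad1 hpA (pel hu) hb hv.2 hv1 (pel_of_order ho) g h1 h2
  have h1 := c.le_A_of inf_le_left hno
  have h2 : centralizer ({u} : Set G) ≤ normalizer (A : Set G) := by
    refine c.S hpA hu hu1 (V := B ⊓ centralizer ({u} : Set G)) inf_le_right
      (nilp_mono inf_le_left c.nB) (c.cop.of_dvd_right (card_dvd_of_le inf_le_left)) ?_
    intro g hg
    obtain ⟨m, hm, b, hb, e⟩ := c.T2 hpq hu hx hx1 hxB hg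
    exact ⟨m, ⟨h1 hm, hm.2⟩, b, hb, e⟩
  apply c.le_A_of h2
  intro s hs hsB v hv
  exact hno s hs hsB v ⟨h2 hv, hv⟩

theorem transferC (c : Ctx A B) {p : ℕ} [hp : Fact p.Prime] {x g : G} (hx : x ∈ pp A p)
    (hgx : g * x * g⁻¹ ∈ pp A p) (hC : centralizer ({x} : Set G) ≤ normalizer (A : Set G)) :
    g ∈ normalizer (A : Set G) ∧
      centralizer ({g * x * g⁻¹} : Set G) ≤ normalizer (A : Set G) := by
  obtain ⟨m, hm, k, hk, e⟩ := c.fusion hx hgx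
  have hg : g ∈ normalizer (A : Set G) := by
    rw [e]; exact mul_mem hm (hC (mem_cent.2 hk))
  refine ⟨hg, fun y hy => ?_⟩
  have h1 : g⁻¹ * y * g⁻¹⁻¹ ∈ centralizer ({x} : Set G) := by
    rw [mem_cent] at hy ⊢
    have := conj_cent (g := g⁻¹) hy
    have e : g⁻¹ * (g * x * g⁻¹) * g⁻¹⁻¹ = x := by group
    rwa [e] at this
  have h2 := mul_mem (mul_mem hg (hC h1)) (inv_mem hg)
  have e : g * (g⁻¹ * y * g⁻¹⁻¹) * g⁻¹ = y := by group
  rwa [e] at h2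

/-- all elements of prime order `s ∣ |B|` commuting with a bad element have the same prime order -/
theorem uniq (c : Ctx A B) : ∃ s0 : ℕ, s0.Prime ∧ s0 ∣ Nat.card B ∧ ∀ {p s : ℕ} [Fact p.Prime] [Fact s.Prime]
    {u v : G}, p ∣ Nat.card A → s ∣ Nat.card B → u ≠ 1 → (∃ k : ℕ, u ^ p ^ k = 1) → Bad A B u →
    v ∈ centralizer ({u} : Set G) → orderOf v = s → s = s0 := by
  obtain ⟨b, hb, hbA, hb1⟩ := c.T
  have hcard : Nat.card (B ⊓ normalizer (A : Set G) : Subgroup G) ≠ 1 := by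
    intro h
    rw [card_eq_one] at h
    have : b ∈ (B ⊓ normalizer (A : Set G) : Subgroup G) := ⟨hb, hbA⟩
    rw [h, mem_bot] at this
    exact hb1 this
  obtain ⟨s0, hs0, hd⟩ := Nat.exists_prime_and_dvd hcard
  haveI := Fact.mk hs0
  obtain ⟨x, hx, hxo⟩ := exists_mem_orderOf hd
  have hxp : x ∈ pp B s0 := mem_pp c.nB hx.1 (pel_of_order hxo)
  have hx1 : x ≠ 1 := by
    rintro rfl; rw [orderOf_one] at hxo; exact hs0.one_lt.ne hxo
  refine ⟨s0, hs0, hd.trans (card_dvd_of_le inf_le_left), ?_⟩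
  intro p s hp hs u v hpA hsB hu1 hu hbad hv hvo
  by_contra hne
  have hv1 : v ≠ 1 := by
    rintro rfl; rw [orderOf_one] at hvo; exact hs.out.one_lt.ne hvo
  have hvb := c.bad1 hpA hu hbad hv hv1 (pel_of_order hvo)
  obtain ⟨g, -, hg⟩ := (c.symm.sylTop hsB).conj_le (Q := zpowers v) le_top
    (isPGroup_zpowers (pel_of_order hvo))
  have hgv := hg v (mem_zpowers v)
  have h1 := c.symm.step1 (Ne.symm hne) hsB (u := g * v * g⁻¹) (by simpa using hv1) hgv hxp hx1
    hx.2 (hvb.conj g)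
  have h2 : g * u * g⁻¹ ∈ B := h1 (mem_cent.2 (conj_cent (mem_cent.1 hv).symm))
  exact c.not_dvd hp.out hpA (dvd_card_of_mem h2 (by simpa using hu1) (pow_conj_pp hu))

theorem step2 (c : Ctx A B) {p : ℕ} [hp : Fact p.Prime] {u : G}
    (hpA : p ∣ Nat.card A) (hu1 : u ≠ 1) (hu : u ∈ pp A p) (hb : Bad A B u) 
    (hsy : IsSyl p (pp A p ⊓ centralizer ({u} : Set G)) (centralizer ({u} : Set G))) :
    centralizer ({u} : Set G) ≤ normalizer (A : Set G) := by
  obtain ⟨s0, hs0, hs0B, huniq⟩ := c.uniq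
  haveI := Fact.mk hs0
  set H := centralizer ({u} : Set G) with hH
  obtain ⟨V, hV, -⟩ := exists_isSyl (p := s0) (Q := ⊥) (H := H) bot_le IsPGroup.of_bot
  have hVc : Nat.card V ∣ Nat.card B := by
    rw [hV.card]
    refine Nat.Coprime.dvd_of_dvd_mul_left (m := Nat.card A) ?_ ?_
    · exact Nat.Coprime.pow_left _ ((Nat.Prime.coprime_iff_not_dvd hs0).2 (c.symm.not_dvd hs0 hs0B))
    · rw [← c.cardG]
      exact (Nat.ordProj_dvd _ _).trans (card_subgroup_dvd_card H)
  have nV : Group.IsNilpotent V := hV.pg.isNilpotent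
  have hcop := c.cop.of_dvd_right hVc
  refine c.S hpA hu hu1 hV.le nV hcop ?_
  apply pr_of_card inf_le_right hV.le (hcop.coprime_dvd_left (card_dvd_of_le inf_le_left))
  rw [← Nat.factorization_prime_le_iff_dvd Nat.card_pos.ne'
    (mul_ne_zero Nat.card_pos.ne' Nat.card_pos.ne')]
  intro r hr
  haveI := Fact.mk hr
  by_cases hrH : r ∣ Nat.card H
  swap
  · rw [Nat.factorization_eq_zero_of_not_dvd hrH]; exact Nat.zero_le _
  have hG : r ∣ Nat.card G := hrH.trans (card_subgroup_dvd_card H)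
  have key : ∀ Q : Subgroup G, IsSyl r Q H → Nat.card Q ∣ Nat.card (A ⊓ H : Subgroup G) * Nat.card V →
      (Nat.card H).factorization r ≤ (Nat.card (A ⊓ H : Subgroup G) * Nat.card V).factorization r := by
    intro Q hQ hd
    rw [hQ.card] at hd
    exact (hr.pow_dvd_iff_le_factorization (mul_ne_zero Nat.card_pos.ne' Nat.card_pos.ne')).1 hd
  rw [c.cardG, hr.dvd_mul] at hG
  rcases hG with hG | hG
  · by_cases hrp : r = p
    · subst hrp
      exact key _ hsy ((card_dvd_of_le (inf_le_inf_right H (pp_le A r))).mul_right _)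
    · have hle : pp A r ≤ H := by
        intro x hx; rw [hH, mem_cent]; exact pp_comm hrp hx hu
      exact key _ (c.syl hG hle) ((card_dvd_of_le (le_inf (pp_le A r) hle)).mul_right _)
  · obtain ⟨v, hv, hvo⟩ := exists_mem_orderOf hrH
    have := huniq hpA hG hu1 (pel hu) hb hv hvo
    subst this
    exact key _ hV (Dvd.intro_left _ rfl)

theorem F (c : Ctx A B) {p : ℕ} [hp : Fact p.Prime] {u : G}
    (hpA : p ∣ Nat.card A) (hu1 : u ≠ 1) (hu : u ∈ pp A p) :
    centralizer ({u} : Set G) ≤ normalizer (A : Set G) := by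
  have tr : ∀ g : G, g * u * g⁻¹ ∈ pp A p →
      centralizer ({g * u * g⁻¹} : Set G) ≤ normalizer (A : Set G) →
      centralizer ({u} : Set G) ≤ normalizer (A : Set G) := by
    intro g hg hC
    have e : g⁻¹ * (g * u * g⁻¹) * g⁻¹⁻¹ = u := by group
    have := (c.transferC (g := g⁻¹) hg (by rw [e]; exact hu) hC).2
    rwa [e] at this
  by_cases hb : Bad A B u
  · obtain ⟨P, hP, -⟩ := exists_isSyl (p := p) (Q := ⊥) (H := centralizer ({u} : Set G)) bot_le
      IsPGroup.of_bot
    have huP : zpowers u ≤ P := by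
      apply hP.normal_le
      · rw [zpowers_le, mem_cent]
      · exact isPGroup_zpowers (pel hu)
      · intro x hx
        apply mem_norm_of_conj
        intro y hy
        have hxu : Commute x u := mem_cent.1 hx
        obtain ⟨n, rfl⟩ := hy
        have := (hxu.zpow_right n).eq
        simp only
        rw [this]; simp
    obtain ⟨g, -, hg⟩ := (c.sylTop hpA).conj_le (Q := P) le_top hP.pg
    have hgu := hg u (huP (mem_zpowers u))
    apply tr g hgu
    refine c.step2 hpA (by simpa using hu1) hgu (hb.conj g) ?_
    have hPg : P.map (MulAut.conj g).toMonoidHom ≤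
        pp A p ⊓ centralizer ({g * u * g⁻¹} : Set G) := by
      rintro _ ⟨x, hx, rfl⟩
      exact ⟨hg x hx, mem_cent.2 (conj_cent (mem_cent.1 (hP.le hx)))⟩
    have hcc : Nat.card (centralizer ({g * u * g⁻¹} : Set G)) = 
        Nat.card (centralizer ({u} : Set G)) := by
      have : centralizer ({g * u * g⁻¹} : Set G) =
          (centralizer ({u} : Set G)).map (MulAut.conj g).toMonoidHom := by
        ext y
        constructor
        · intro hy
          refine ⟨g⁻¹ * y * g⁻¹⁻¹, ?_, ?_⟩
          · have := conj_cent (g := g⁻¹) (mem_cent.1 hy)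
            have e : g⁻¹ * (g * u * g⁻¹) * g⁻¹⁻¹ = u := by group
            rw [e] at this
            exact mem_cent.2 this
          · change g * (g⁻¹ * y * g⁻¹⁻¹) * g⁻¹ = y
            group
        · rintro ⟨x, hx, rfl⟩
          exact mem_cent.2 (conj_cent (mem_cent.1 hx))
      rw [this]
      exact card_map_of_injective (MulAut.conj g).injective
    have hPc : Nat.card (P.map (MulAut.conj g).toMonoidHom) = Nat.card P :=
      card_map_of_injective (MulAut.conj g).injective
    have hs : IsSyl p (P.map (MulAut.conj g).toMonoidHom) (centralizer ({g * u * g⁻¹} : Set G)) := by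
      apply isSyl_of_card (hPg.trans inf_le_right)
      rw [hPc, hcc, hP.card]
    refine ⟨inf_le_right, (pp_isPGroup A p).to_le inf_le_left, fun h => hs.ndvd ?_⟩
    exact h.trans (relIndex_dvd_of_le_left _ hPg)
  · unfold Bad at hb
    push Not at hb
    obtain ⟨g, h1, h2, -⟩ := hb
    have h3 := mem_pp c.nA h1 (pow_conj_pp (pel hu))
    exact tr g h3 (c.CaLe h3 (by simpa using hu1) h2)

theorem TI (c : Ctx A B) {g y : G} (hy : y ∈ A) (hgy : g * y * g⁻¹ ∈ A) (hy1 : y ≠ 1) :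
    g ∈ normalizer (A : Set G) := by
  have ho : orderOf y ≠ 1 := fun h => hy1 (orderOf_eq_one_iff.1 h)
  obtain ⟨p, hp, hd⟩ := Nat.exists_prime_and_dvd ho
  haveI := Fact.mk hp
  obtain ⟨w, hw, hwo⟩ := exists_mem_orderOf (p := p) (H := zpowers y) (by rwa [Nat.card_zpowers])
  have hw1 : w ≠ 1 := by
    rintro rfl; rw [orderOf_one] at hwo; exact hp.one_lt.ne hwo
  have hwA : w ∈ A := (zpowers_le.2 hy) hw
  have hgw : g * w * g⁻¹ ∈ A := by
    obtain ⟨n, rfl⟩ := hw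
    have := zpow_mem hgy n
    rwa [conj_zpow] at this
  have hwp := mem_pp c.nA hwA (pel_of_order hwo)
  have hgp := mem_pp c.nA hgw (pow_conj_pp (pel_of_order hwo))
  have hpA : p ∣ Nat.card A := dvd_card_of_mem hwA hw1 (pel_of_order hwo)
  exact (c.transferC hwp hgp (c.F hpA hw1 hwp)).1

theorem card_le (c : Ctx A B) : Nat.card A ≤ Nat.card B := by
  obtain ⟨g, hg⟩ : ∃ g, g ∉ normalizer (A : Set G) := by
    by_contra h
    push Not at h
    exact c.M0_ne_top (eq_top_iff.2 fun x _ => h x)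
  have hinj : Function.Injective (fun w : A × A => (w.1 : G) * g * w.2) := by
    rintro ⟨⟨a, ha⟩, ⟨a', ha'⟩⟩ ⟨⟨b, hb⟩, ⟨b', hb'⟩⟩ h
    have h0 : a * g * a' = b * g * b' := h
    have h1 : g * (b' * a'⁻¹) * g⁻¹ = b⁻¹ * a := by
      have : b⁻¹ * (a * g * a') * (a'⁻¹ * g⁻¹) = b⁻¹ * a := by group
      rw [← this, h0]; group
    have h2 : b' * a'⁻¹ = 1 := by
      by_contra hne
      exact hg (c.TI (mul_mem hb' (inv_mem ha')) (h1 ▸ mul_mem (inv_mem hb) ha) hne)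
    rw [h2] at h1
    have h3 : b⁻¹ * a = 1 := by rw [← h1]; group
    have e1 : b = a := inv_mul_eq_one.1 h3
    have e2 : b' = a' := mul_inv_eq_one.1 h2
    subst e1; subst e2; rfl
  have := Nat.card_le_card_of_injective _ hinj
  rw [Nat.card_prod, c.cardG] at this
  exact Nat.le_of_mul_le_mul_left this Nat.card_pos

theorem absurd (c : Ctx A B) : False := by
  have h := le_antisymm c.card_le c.symm.card_le
  have := c.cop
  rw [← h, Nat.coprime_self, card_eq_one] at this
  exact c.A_ne_bot this

end Ctx
end fin2
end KW

namespace KW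

set_option linter.unusedSectionVars false
set_option linter.style.haveILetI false

section algint

theorem multiset_norm_sum_le (l : Multiset ℂ) (h : ∀ z ∈ l, ‖z‖ = 1) : ‖l.sum‖ ≤ Multiset.card l := by
  induction l using Multiset.induction with
  | empty => simp
  | cons a s ih =>
    rw [Multiset.sum_cons, Multiset.card_cons]
    have h1 := ih fun z hz => h z (Multiset.mem_cons_of_mem hz)
    have h2 := h a (Multiset.mem_cons_self a s)
    have h3 := norm_add_le a s.sum
    push_cast
    linarith

theorem all_eq_of_norm (l : Multiset ℂ) (h : ∀ z ∈ l, ‖z‖ = 1) (w : ℂ) (hw : ‖w‖ = 1)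
    (hs : w * Multiset.card l = l.sum) : ∀ z ∈ l, z = w := by
  have hww : w.re * w.re + w.im * w.im = 1 := by
    have := Complex.normSq_eq_norm_sq w
    rw [hw, Complex.normSq_apply] at this
    linarith
  have hre : l.sum.re = (l.map fun z => z.re).sum := by
    exact map_multiset_sum Complex.reAddGroupHom l
  have him : l.sum.im = (l.map fun z => z.im).sum := by
    exact map_multiset_sum Complex.imAddGroupHom l
  set f : ℂ → ℝ := fun z => 1 - (z.re * w.re + z.im * w.im) with hf
  have hnn : ∀ z ∈ l, 2 * f z = (z.re - w.re) ^ 2 + (z.im - w.im) ^ 2 := by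
    intro z hz
    have h1 : z.re * z.re + z.im * z.im = 1 := by
      have := Complex.normSq_eq_norm_sq z
      rw [h z hz, Complex.normSq_apply] at this
      linarith
    simp only [hf]
    linarith
  have hsum : (l.map f).sum = 0 := by
    simp only [hf]
    rw [Multiset.sum_map_sub, Multiset.sum_map_add, Multiset.sum_map_mul_right,
      Multiset.sum_map_mul_right, ← hre, ← him, ← hs]
    simp
    linear_combination (-(Multiset.card l : ℝ)) * hww
  intro z hz
  have h0 : f z ≤ 0 := by
    rw [← hsum]
    apply Multiset.single_le_sum
    · intro x hx
      obtain ⟨y, hy, rfl⟩ := Multiset.mem_map.1 hx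
      have := hnn y hy
      nlinarith [sq_nonneg (y.re - w.re), sq_nonneg (y.im - w.im)]
    · exact Multiset.mem_map_of_mem f hz
  have h1 := hnn z hz
  have h2 : (z.re - w.re) ^ 2 = 0 := by nlinarith [sq_nonneg (z.re - w.re), sq_nonneg (z.im - w.im)]
  have h3 : (z.im - w.im) ^ 2 = 0 := by nlinarith [sq_nonneg (z.re - w.re), sq_nonneg (z.im - w.im)]
  apply Complex.ext
  · exact sub_eq_zero.1 (pow_eq_zero_iff (two_ne_zero) |>.1 h2)
  · exact sub_eq_zero.1 (pow_eq_zero_iff (two_ne_zero) |>.1 h3)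

open Polynomial in
theorem zero_or_norm_one {t : ℂ} (ht : IsIntegral ℤ t)
    (hc : ∀ r ∈ (minpoly ℚ t).rootSet ℂ, ‖r‖ ≤ 1) : t = 0 ∨ 1 ≤ ‖t‖ := by
  by_contra hcon
  push Not at hcon
  obtain ⟨h0, h1⟩ := hcon
  have hq : minpoly ℚ t = (minpoly ℤ t).map (algebraMap ℤ ℚ) :=
    minpoly.isIntegrallyClosed_eq_field_fractions' ℚ ht
  have htQ : IsIntegral ℚ t := ht.tower_top
  set P := (minpoly ℚ t).map (algebraMap ℚ ℂ) with hP
  have hPm : P.Monic := (minpoly.monic htQ).map _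
  have hsp : P.Splits := IsAlgClosed.splits P
  have hmem : t ∈ P.roots := by
    rw [mem_roots hPm.ne_zero, IsRoot, hP, eval_map_algebraMap, minpoly.aeval]
  have hle : ∀ r ∈ P.roots, ‖r‖ ≤ 1 := by
    intro r hr
    apply hc
    rw [mem_rootSet]
    refine ⟨minpoly.ne_zero htQ, ?_⟩
    rw [mem_roots hPm.ne_zero, IsRoot, hP, eval_map_algebraMap] at hr
    exact hr
  have hprod : P.coeff 0 = (-1) ^ P.natDegree * P.roots.prod :=
    hsp.coeff_zero_eq_prod_roots_of_monic hPm
  have hnorm : ‖P.coeff 0‖ < 1 := by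
    rw [hprod, norm_mul, norm_pow, norm_neg, norm_one, one_pow, one_mul]
    obtain ⟨s, hs⟩ := Multiset.exists_cons_of_mem hmem
    rw [hs, Multiset.prod_cons, norm_mul]
    have h2 : ∀ s : Multiset ℂ, (∀ r ∈ s, ‖r‖ ≤ 1) → ‖s.prod‖ ≤ 1 := by
      intro s
      induction s using Multiset.induction with
      | empty => simp
      | cons a s ih =>
        intro h
        rw [Multiset.prod_cons, norm_mul]
        exact mul_le_one₀ (h a (Multiset.mem_cons_self a s)) (norm_nonneg _)
          (ih fun r hr => h r (Multiset.mem_cons_of_mem hr))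
    have h3 := h2 s fun r hr => hle r (by rw [hs]; exact Multiset.mem_cons_of_mem hr)
    calc ‖t‖ * ‖s.prod‖ ≤ ‖t‖ * 1 := by gcongr
      _ < 1 := by linarith
  have hcoe : P.coeff 0 = (((minpoly ℤ t).coeff 0 : ℤ) : ℂ) := by
    rw [hP, hq]; simp
  have hz : (minpoly ℤ t).coeff 0 = 0 := by
    rw [hcoe] at hnorm
    rw [Complex.norm_intCast] at hnorm
    have : |(minpoly ℤ t).coeff 0| < 1 := by exact_mod_cast hnorm
    exact Int.abs_lt_one_iff.1 this
  have hz' : (minpoly ℚ t).coeff 0 = 0 := by rw [hq]; simp [hz]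
  exact h0 ((minpoly.coeff_zero_eq_zero htQ).1 hz')

theorem avg_roots {t : ℂ} (ht : IsIntegral ℤ t) {l : Multiset ℂ} {n : ℕ} (hn : n ≠ 0)
    (hl : ∀ z ∈ l, z ^ n = 1) (hc : Multiset.card l ≠ 0) (hs : t * Multiset.card l = l.sum) :
    t = 0 ∨ ∀ z ∈ l, z = t := by
  have hnorm : ∀ z : ℂ, z ^ n = 1 → ‖z‖ = 1 := fun z hz => Complex.norm_eq_one_of_pow_eq_one hz hn
  have hc' : (Multiset.card l : ℂ) ≠ 0 := by exact_mod_cast hc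
  have hcr : (0 : ℝ) < Multiset.card l := by exact_mod_cast Nat.pos_of_ne_zero hc
  have hb : ∀ (m : Multiset ℂ) (r : ℂ), Multiset.card m = Multiset.card l →
      (∀ z ∈ m, z ^ n = 1) → r * Multiset.card l = m.sum → ‖r‖ ≤ 1 := by
    intro m r hm hz hr
    have h1 := multiset_norm_sum_le m fun z h => hnorm z (hz z h)
    rw [← hr, norm_mul, Complex.norm_natCast, hm] at h1
    exact le_of_mul_le_mul_right (by linarith) hcr
  let K := algebraicClosure ℚ ℂ
  have hK : ∀ z : ℂ, z ^ n = 1 → z ∈ K := by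
    intro z hz
    rw [mem_algebraicClosure_iff]
    apply IsIntegral.isAlgebraic
    exact IsIntegral.of_pow (Nat.pos_of_ne_zero hn) (by rw [hz]; exact isIntegral_one)
  have htK : t ∈ K := by
    rw [mem_algebraicClosure_iff]
    exact (ht.tower_top (A := ℚ)).isAlgebraic
  have hcase := zero_or_norm_one ht (by
    intro r hr
    have e : minpoly ℚ t = minpoly ℚ (⟨t, htK⟩ : K) :=
      minpoly.algebraMap_eq (A := ℚ) (B := K) (B' := ℂ) Subtype.val_injective ⟨t, htK⟩
    haveI : Algebra.IsAlgebraic ℚ K := algebraicClosure.isAlgebraic ℚ ℂ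
    rw [e, ← Algebra.IsAlgebraic.range_eval_eq_rootSet_minpoly] at hr
    obtain ⟨σ, rfl⟩ := hr
    let l' : Multiset K := l.attach.map fun z => ⟨z.1, hK z.1 (hl z.1 z.2)⟩
    have hl' : l'.map (algebraMap K ℂ) = l := by
      simp only [l', Multiset.map_map]
      exact Multiset.attach_map_val l
    have hcl : Multiset.card l' = Multiset.card l := by simp [l']
    apply hb (l'.map σ) _ (by rw [Multiset.card_map, hcl])
    · intro z hz
      obtain ⟨y, hy, rfl⟩ := Multiset.mem_map.1 hz
      have : (algebraMap K ℂ y) ^ n = 1 := hl _ (by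
        rw [← hl']; exact Multiset.mem_map_of_mem _ hy)
      have h2 : y ^ n = 1 := by
        apply (algebraMap K ℂ).injective
        rw [map_pow, this, map_one]
      rw [← map_pow, h2, map_one]
    · have h2 : (⟨t, htK⟩ : K) * (Multiset.card l : K) = l'.sum := by
        apply (algebraMap K ℂ).injective
        rw [map_mul, map_natCast, map_multiset_sum, hl']
        exact hs
      have h3 := congrArg σ h2
      rw [map_mul, map_natCast, map_multiset_sum] at h3
      exact h3)
  rcases hcase with h | h
  · exact Or.inl h
  · right
    exact all_eq_of_norm l (fun z hz => hnorm z (hl z hz)) t (le_antisymm (hb l t rfl hl hs) h) hs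

end algint
end KW

namespace KW

set_option linter.unusedSectionVars false
set_option linter.style.haveILetI false

section rep

open Polynomial in
theorem root_pow {d n : ℕ} {M : Matrix (Fin d) (Fin d) ℂ} (hM : M ^ n = 1) {z : ℂ}
    (hz : z ∈ M.charpoly.roots) : z ^ n = 1 := by
  have h1 : IsRoot M.charpoly z := (mem_roots'.1 hz).2
  have h2 : z ∈ spectrum ℂ M := Matrix.mem_spectrum_iff_isRoot_charpoly.2 h1
  haveI : Nontrivial (Matrix (Fin d) (Fin d) ℂ) := by
    by_contra h
    rw [not_nontrivial_iff_subsingleton] at h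
    rw [spectrum.mem_iff] at h2
    exact h2 (isUnit_of_subsingleton _)
  have h3 := spectrum.pow_image_subset M n (Set.mem_image_of_mem _ h2)
  rw [hM, spectrum.one_eq] at h3
  exact h3

open Polynomial in
theorem scalar_of_roots {d n : ℕ} (hn : n ≠ 0) {M : Matrix (Fin d) (Fin d) ℂ} (hM : M ^ n = 1) {t : ℂ}
    (h : ∀ z ∈ M.charpoly.roots, z = t) (hd : d ≠ 0) :
    M = algebraMap ℂ (Matrix (Fin d) (Fin d) ℂ) t := by
  have hr : M.charpoly.roots = Multiset.replicate (Multiset.card M.charpoly.roots) t :=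
    Multiset.eq_replicate_card.2 h
  have hsp : M.charpoly.Splits := IsAlgClosed.splits _
  have hc : Multiset.card M.charpoly.roots = d := by
    rw [← hsp.natDegree_eq_card_roots, Matrix.charpoly_natDegree_eq_dim, Fintype.card_fin]
  have hp : M.charpoly = (X - C t) ^ d := by
    rw [hsp.eq_prod_roots_of_monic M.charpoly_monic, hr, hc]
    simp
  have hmin : minpoly ℂ M ∣ X ^ n - C 1 := by
    apply minpoly.dvd
    simp [hM]
  have hsq : Squarefree (minpoly ℂ M) :=
    ((separable_X_pow_sub_C (1:ℂ) (by exact_mod_cast hn) one_ne_zero).squarefree).squarefree_of_dvd hmin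
  have h2 : minpoly ℂ M ∣ (X - C t) ^ d := by
    rw [← hp]; exact Matrix.minpoly_dvd_charpoly M
  have h3 := (hsq.dvd_pow_iff_dvd hd).1 h2
  have h4 : aeval M (X - C t) = 0 := by
    obtain ⟨q, hq⟩ := h3
    rw [hq, map_mul, minpoly.aeval, zero_mul]
  rw [map_sub, aeval_X, aeval_C, sub_eq_zero] at h4
  exact h4

variable {G : Type*} [Group G] [Finite G]

theorem rho_pow {d : ℕ} (ρ : G →* Matrix (Fin d) (Fin d) ℂ) (g : G) :
    ρ g ^ Nat.card G = 1 := by rw [← map_pow, pow_card_eq_one', map_one]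

theorem trace_integral {d : ℕ} (ρ : G →* Matrix (Fin d) (Fin d) ℂ) (g : G) :
    IsIntegral ℤ (ρ g).trace := by
  rw [Matrix.trace_eq_sum_roots_charpoly]
  apply IsIntegral.multiset_sum
  intro z hz
  exact IsIntegral.of_pow (n := Nat.card G) Nat.card_pos
    (by rw [root_pow (rho_pow ρ g) hz]; exact isIntegral_one)

theorem irr {d : ℕ} (hd : d ≠ 0) (ρ : G →* Matrix (Fin d) (Fin d) ℂ)
    (schur : ∀ M : Matrix (Fin d) (Fin d) ℂ, (∀ h, ρ h * M = M * ρ h) → ∃ w : ℂ, M = algebraMap ℂ _ w)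
    {g : G} {S : Finset G} (hS : ∀ x, x ∈ S ↔ IsConj g x)
    (hcop : Nat.Coprime S.card d) : (ρ g).trace = 0 ∨ ∃ w : ℂ, ρ g = algebraMap ℂ _ w := by
  have hconj : ∀ k x, x ∈ S → k * x * k⁻¹ ∈ S := by
    intro k x hx
    rw [hS] at *
    exact hx.trans (isConj_iff.2 ⟨k, rfl⟩)
  obtain ⟨w, hw⟩ := schur (∑ h ∈ S, ρ h) (by
    intro k
    have h1 : ∑ h ∈ S, ρ h = ∑ h ∈ S, ρ (k * h * k⁻¹) := by
      symm
      refine Finset.sum_bij' (fun h _ => k * h * k⁻¹) (fun h _ => k⁻¹ * h * k) ?_ ?_ ?_ ?_ ?_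
      · intro x hx; exact hconj k x hx
      · intro x hx; simpa using hconj k⁻¹ x hx
      · intro x _; group
      · intro x _; group
      · intro x _; rfl
    conv_rhs => rw [h1]
    rw [Finset.mul_sum, Finset.sum_mul]
    refine Finset.sum_congr rfl fun x _ => ?_
    rw [← map_mul, ← map_mul]
    congr 1
    group)
  have hwint : IsIntegral ℤ w := by
    have h1 : IsIntegral ℤ (∑ h ∈ S, MonoidAlgebra.single h (1:ℤ) : MonoidAlgebra ℤ G) := by
      haveI : Module.Finite ℤ (MonoidAlgebra ℤ G) := Module.Finite.of_basis (MonoidAlgebra.basis G ℤ)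
      exact IsIntegral.of_finite ℤ _
    have h2 := h1.map (MonoidAlgebra.lift ℤ (Matrix (Fin d) (Fin d) ℂ) G ρ)
    rw [map_sum] at h2
    simp only [MonoidAlgebra.lift_single, one_smul] at h2
    rw [hw] at h2
    haveI : Nonempty (Fin d) := ⟨⟨0, Nat.pos_of_ne_zero hd⟩⟩
    exact (isIntegral_algHom_iff ((Algebra.ofId ℂ (Matrix (Fin d) (Fin d) ℂ)).restrictScalars ℤ)
      (algebraMap ℂ (Matrix (Fin d) (Fin d) ℂ)).injective).1 h2
  have htr : (S.card : ℂ) * (ρ g).trace = d * w := by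
    have h1 := congrArg Matrix.trace hw
    rw [Matrix.trace_sum, Matrix.algebraMap_eq_diagonal, Matrix.trace_diagonal] at h1
    have h2 : ∀ x ∈ S, (ρ x).trace = (ρ g).trace := by
      intro x hx
      obtain ⟨k, rfl⟩ := isConj_iff.1 ((hS x).1 hx)
      rw [map_mul, map_mul, Matrix.trace_mul_comm, ← mul_assoc, ← map_mul]
      simp
    rw [Finset.sum_congr rfl h2] at h1
    simpa using h1
  have hdC : (d : ℂ) ≠ 0 := by exact_mod_cast hd
  set t : ℂ := (ρ g).trace / d with ht
  have htd : t * d = (ρ g).trace := by rw [ht]; field_simp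
  have htint : IsIntegral ℤ t := by
    have hb : (S.card : ℤ) * Nat.gcdA S.card d + d * Nat.gcdB S.card d = 1 := by
      have := Nat.gcd_eq_gcd_ab S.card d
      rw [hcop] at this
      exact_mod_cast this.symm
    have hbC : (S.card : ℂ) * (Nat.gcdA S.card d : ℂ) + d * (Nat.gcdB S.card d : ℂ) = 1 := by
      exact_mod_cast hb
    have e : t = (Nat.gcdA S.card d : ℂ) * w + (Nat.gcdB S.card d : ℂ) * (ρ g).trace := by
      have e1 : (S.card : ℂ) * t = w := by
        rw [ht, ← mul_div_assoc, htr]; field_simp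
      rw [← e1, ← htd]
      linear_combination (-t) * hbC
    rw [e]
    have hi : ∀ m : ℤ, IsIntegral ℤ (m : ℂ) := fun m => isIntegral_algebraMap (R := ℤ) (A := ℂ) (x := m)
    exact ((hi _).mul hwint).add ((hi _).mul (trace_integral ρ g))
  have hsp : (ρ g).charpoly.Splits := IsAlgClosed.splits _
  have hc : Multiset.card (ρ g).charpoly.roots = d := by
    rw [← hsp.natDegree_eq_card_roots, Matrix.charpoly_natDegree_eq_dim, Fintype.card_fin]
  rcases avg_roots (l := (ρ g).charpoly.roots) htint (Nat.card_pos (α := G)).ne'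
    (fun z hz => root_pow (rho_pow ρ g) hz) (by rw [hc]; exact hd)
    (by rw [hc, htd, Matrix.trace_eq_sum_roots_charpoly]) with h | h
  · left; rw [← htd, h, zero_mul]
  · right; exact ⟨t, scalar_of_roots Nat.card_pos.ne' (rho_pow ρ g) h hd⟩

theorem trace_left_pi {n : ℕ} {d : Fin n → ℕ} (x : Π i, Matrix (Fin (d i)) (Fin (d i)) ℂ) :
    LinearMap.trace ℂ _ (LinearMap.mulLeft ℂ x) = ∑ i, (d i : ℂ) * (x i).trace := by
  rw [LinearMap.trace_eq_matrix_trace ℂ (Pi.basis fun i => Matrix.stdBasis ℂ (Fin (d i)) (Fin (d i)))]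
  rw [Matrix.trace, Fintype.sum_sigma]
  refine Finset.sum_congr rfl fun i _ => ?_
  rw [Fintype.sum_prod_type, Matrix.trace, Finset.mul_sum]
  refine Finset.sum_congr rfl fun a _ => ?_
  have : ∀ b : Fin (d i), Matrix.diag (LinearMap.toMatrix
      (Pi.basis fun i => Matrix.stdBasis ℂ (Fin (d i)) (Fin (d i)))
      (Pi.basis fun i => Matrix.stdBasis ℂ (Fin (d i)) (Fin (d i))) (LinearMap.mulLeft ℂ x))
      ⟨i, (a, b)⟩ = x i a a := by
    intro b
    rw [Matrix.diag_apply, LinearMap.toMatrix_apply, LinearMap.mulLeft_apply, Pi.basis_repr,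
      Pi.basis_apply]
    simp [Matrix.stdBasis]
    rw [Matrix.mul_apply, Finset.sum_eq_single a]
    · simp
    · intro c _ hc; simp [hc]
    · simp
  rw [Finset.sum_congr rfl fun b _ => this b]
  simp

theorem trace_left_group {g : G} (hg : g ≠ 1) :
    LinearMap.trace ℂ _ (LinearMap.mulLeft ℂ (MonoidAlgebra.single g (1:ℂ))) = 0 := by
  classical
  haveI := Fintype.ofFinite G
  rw [LinearMap.trace_eq_matrix_trace ℂ (MonoidAlgebra.basis G ℂ), Matrix.trace]
  refine Finset.sum_eq_zero fun h _ => ?_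
  rw [Matrix.diag_apply, LinearMap.toMatrix_apply, LinearMap.mulLeft_apply,
    MonoidAlgebra.basis_apply, MonoidAlgebra.single_mul_single]
  change (MonoidAlgebra.single (g * h) ((1:ℂ) * 1)).coeff h = 0
  simp [hg]

end rep
end KW

namespace KW

set_option linter.unusedSectionVars false
set_option linter.style.haveILetI false

section burn
variable {G : Type*} [Group G] [Finite G]

theorem not_integral {p : ℕ} (hp : p.Prime) {z : ℂ} (hz : IsIntegral ℤ z) (h : 1 + (p : ℂ) * z = 0) :
    False := by
  have hp0 : (p : ℂ) ≠ 0 := by exact_mod_cast hp.ne_zero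
  have hzq : z = algebraMap ℚ ℂ (-1 / p) := by
    simp
    field_simp
    linear_combination h
  rw [hzq, isIntegral_algebraMap_iff (algebraMap ℚ ℂ).injective] at hz
  obtain ⟨m, hm⟩ := IsIntegrallyClosed.isIntegral_iff.1 hz
  have hp1 : (p : ℚ) ≠ 0 := by exact_mod_cast hp.ne_zero
  have h2 : (p : ℤ) * (-m) = 1 := by
    have : (p : ℚ) * (-m) = 1 := by
      simp at hm
      rw [hm]; field_simp
    exact_mod_cast this
  have h3 : (p : ℤ) ∣ 1 := ⟨-m, h2.symm⟩
  have : p ∣ 1 := by exact_mod_cast h3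
  exact hp.one_lt.ne' (Nat.dvd_one.1 this)

theorem burnside_aux (simple : ∀ N : Subgroup G, N.Normal → N = ⊥ ∨ N = ⊤)
    (cen : ∀ z : G, (∀ g, g * z = z * g) → z = 1) {g : G} (hg : g ≠ 1)
    {S : Finset G} (hS : ∀ x, x ∈ S ↔ IsConj g x) {p k : ℕ} (hp : p.Prime)
    (hk : S.card = p ^ k) : False := by
  classical
  haveI := Fintype.ofFinite G
  haveI : NeZero (Nat.card G : ℂ) := ⟨by exact_mod_cast (Nat.card_pos (α := G)).ne'⟩
  haveI : FiniteDimensional ℂ (MonoidAlgebra ℂ G) := Module.Finite.of_basis (MonoidAlgebra.basis G ℂ)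
  obtain ⟨n, d, hd, ⟨φ⟩⟩ :=
    IsSemisimpleRing.exists_algEquiv_pi_matrix_of_isAlgClosed ℂ (MonoidAlgebra ℂ G)
  let ρ : ∀ i, G →* Matrix (Fin (d i)) (Fin (d i)) ℂ := fun i =>
    { toFun := fun h => φ (MonoidAlgebra.of ℂ G h) i
      map_one' := by rw [map_one, map_one]; rfl
      map_mul' := fun a b => by rw [map_mul, map_mul]; rfl }
  have hρ : ∀ i h, ρ i h = φ (MonoidAlgebra.of ℂ G h) i := fun i h => rfl
  have hd0 : ∀ i, d i ≠ 0 := fun i => (hd i).ne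
  have surj : ∀ i (M : Matrix (Fin (d i)) (Fin (d i)) ℂ), ∃ x, φ x = Pi.single i M := fun i M =>
    ⟨φ.symm (Pi.single i M), φ.apply_symm_apply _⟩
  have schur : ∀ i, ∀ M : Matrix (Fin (d i)) (Fin (d i)) ℂ, (∀ h, ρ i h * M = M * ρ i h) →
      ∃ w : ℂ, M = algebraMap ℂ _ w := by
    intro i M hM
    have h1 : ∀ x, φ x i * M = M * φ x i := by
      intro x
      induction x using MonoidAlgebra.induction_on with
      | of m => exact hM m
      | add x y hx hy => rw [map_add, Pi.add_apply, add_mul, mul_add, hx, hy]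
      | smul r x hx => rw [map_smul, Pi.smul_apply, smul_mul_assoc, mul_smul_comm, hx]
    obtain ⟨w, hw⟩ := Matrix.mem_range_scalar_of_commute_single (M := M) (by
      intro a b _
      obtain ⟨x, hx⟩ := surj i (Matrix.single a b 1)
      have := h1 x
      rw [hx, Pi.single_eq_same] at this
      exact this)
    exact ⟨w, hw.symm⟩
  have triv : ∀ i, (∀ h, ρ i h = 1) → ∀ x, φ x i =
      algebraMap ℂ _ (MonoidAlgebra.lift ℂ ℂ G (1 : G →* ℂ) x) := by
    intro i hi x
    induction x using MonoidAlgebra.induction_on with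
    | of m => rw [← hρ, hi]; simp
    | add x y hx hy => rw [map_add, Pi.add_apply, hx, hy, map_add, map_add]
    | smul r x hx => rw [map_smul, Pi.smul_apply, hx, map_smul, smul_eq_mul, map_mul, Algebra.smul_def]
  have triv_uniq : ∀ i j, (∀ h, ρ i h = 1) → (∀ h, ρ j h = 1) → i = j := by
    intro i j hi hj
    by_contra hij
    obtain ⟨x, hx⟩ := surj i 1
    haveI := hd i
    haveI := hd j
    have h1 := triv i hi x
    have h2 := triv j hj x
    rw [hx, Pi.single_eq_same] at h1
    rw [hx, Pi.single_eq_of_ne (Ne.symm hij)] at h2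
    have h3 := (algebraMap ℂ (Matrix (Fin (d j)) (Fin (d j)) ℂ)).injective (h2.symm.trans (map_zero _).symm)
    rw [h3, map_zero] at h1
    exact one_ne_zero h1
  have triv_dim : ∀ i, (∀ h, ρ i h = 1) → d i = 1 := by
    intro i hi
    by_contra hne
    have h2 : 2 ≤ d i := by have := hd0 i; omega
    obtain ⟨x, hx⟩ := surj i (Matrix.single ⟨0, by omega⟩ ⟨1, by omega⟩ 1)
    have h1 := triv i hi x
    rw [hx, Pi.single_eq_same] at h1
    have h3 := congrFun (congrFun h1 ⟨0, by omega⟩) ⟨1, by omega⟩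
    rw [Matrix.algebraMap_matrix_apply] at h3
    simp at h3
  obtain ⟨i0, hi0⟩ : ∃ i, ∀ h, ρ i h = 1 := by
    let e : MonoidAlgebra ℂ G := ∑ h : G, MonoidAlgebra.of ℂ G h
    have hl : ∀ h, MonoidAlgebra.of ℂ G h * e = e := by
      intro h
      simp only [e, Finset.mul_sum, ← map_mul]
      exact Fintype.sum_equiv (Equiv.mulLeft h) _ _ (fun x => rfl)
    have hr : ∀ h, e * MonoidAlgebra.of ℂ G h = e := by
      intro h
      simp only [e, Finset.sum_mul, ← map_mul]
      exact Fintype.sum_equiv (Equiv.mulRight h) _ _ (fun x => rfl)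
    have he : e ≠ 0 := by
      intro h0
      have := congrArg (MonoidAlgebra.lift ℂ ℂ G (1 : G →* ℂ)) h0
      simp [e] at this
    have hφ : φ e ≠ 0 := by
      intro h0
      exact he (φ.injective (h0.trans (map_zero φ).symm))
    obtain ⟨i, hi⟩ : ∃ i, φ e i ≠ 0 := by
      by_contra hcon
      push Not at hcon
      exact hφ (funext hcon)
    have h1 : ∀ h, ρ i h * φ e i = φ e i := fun h => by
      rw [hρ, ← Pi.mul_apply, ← map_mul, hl]
    have h2 : ∀ h, φ e i * ρ i h = φ e i := fun h => by
      rw [hρ, ← Pi.mul_apply, ← map_mul, hr]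
    obtain ⟨w, hw⟩ := schur i (φ e i) (fun h => by rw [h1, h2])
    have hw0 : w ≠ 0 := by
      rintro rfl
      rw [map_zero] at hw
      exact hi hw
    refine ⟨i, fun h => ?_⟩
    have h3 := h1 h
    rw [hw, Algebra.algebraMap_eq_smul_one, mul_smul_comm, mul_one] at h3
    exact smul_right_injective _ hw0 h3
  have hsum : ∑ i, (d i : ℂ) * (ρ i g).trace = 0 := by
    have h1 := trace_left_pi (φ (MonoidAlgebra.of ℂ G g))
    have h2 := LinearMap.trace_conj' (LinearMap.mulLeft ℂ (MonoidAlgebra.single g (1:ℂ))) φ.toLinearEquiv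
    rw [trace_left_group hg] at h2
    have h3 : φ.toLinearEquiv.conj (LinearMap.mulLeft ℂ (MonoidAlgebra.single g (1:ℂ))) =
        LinearMap.mulLeft ℂ (φ (MonoidAlgebra.of ℂ G g)) := by
      refine LinearMap.ext fun x => ?_
      rw [LinearEquiv.conj_apply_apply, LinearMap.mulLeft_apply, LinearMap.mulLeft_apply]
      change φ (_ * φ.symm x) = _
      rw [map_mul, φ.apply_symm_apply]
      rfl
    rw [h3, h1] at h2
    exact h2
  have hterm : ∀ i, i ≠ i0 → ∃ z : ℂ, IsIntegral ℤ z ∧ (d i : ℂ) * (ρ i g).trace = p * z := by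
    intro i hi
    by_cases hpd : p ∣ d i
    · obtain ⟨m, hm⟩ := hpd
      refine ⟨(m : ℂ) * (ρ i g).trace, ?_, ?_⟩
      · have hi : IsIntegral ℤ (m : ℂ) := by
          have := isIntegral_algebraMap (R := ℤ) (A := ℂ) (x := (m : ℤ))
          simpa using this
        exact hi.mul (trace_integral _ g)
      · have hmC : (d i : ℂ) = p * m := by exact_mod_cast hm
        rw [hmC]; ring
    · rcases irr (hd0 i) (ρ i) (schur i) hS (by
        rw [hk]; exact Nat.Coprime.pow_left _ ((Nat.Prime.coprime_iff_not_dvd hp).2 hpd)) with h | ⟨w, h⟩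
      · exact ⟨0, isIntegral_zero, by rw [h]; simp⟩
      · exfalso
        rcases simple (ρ i).ker inferInstance with h1 | h1
        · have hinj : Function.Injective (ρ i) := (MonoidHom.ker_eq_bot_iff _).1 h1
          exact hg (cen g fun x => hinj (by
            rw [map_mul, map_mul, h]; exact (Algebra.commutes w _).symm))
        · refine hi (triv_uniq i i0 (fun x => ?_) hi0)
          have : x ∈ (ρ i).ker := by rw [h1]; trivial
          exact this
  choose! z hz1 hz2 using hterm
  rw [← Finset.add_sum_erase _ _ (Finset.mem_univ i0), hi0 g] at hsum
  rw [Finset.sum_congr rfl (fun i hi => hz2 i (Finset.ne_of_mem_erase hi)), ← Finset.mul_sum,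
    Matrix.trace_one, Fintype.card_fin, triv_dim i0 hi0] at hsum
  refine not_integral hp (z := ∑ i ∈ Finset.univ.erase i0, z i) ?_ ?_
  · exact IsIntegral.sum _ (fun i hi => hz1 i (Finset.ne_of_mem_erase hi))
  · simpa using hsum

theorem burnside (simple : ∀ N : Subgroup G, N.Normal → N = ⊥ ∨ N = ⊤)
    (cen : ∀ z : G, (∀ g, g * z = z * g) → z = 1) {g : G} (hg : g ≠ 1)
    {p k : ℕ} (hp : p.Prime)
    (hk : (Subgroup.centralizer {g}).index = p ^ k) : False := by
  classical
  have hfin : (MulAction.orbit (ConjAct G) g).Finite := Set.toFinite _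
  refine burnside_aux simple cen hg (S := hfin.toFinset) ?_ hp (k := k) ?_
  · intro x
    rw [Set.Finite.mem_toFinset, ConjAct.mem_orbit_conjAct, isConj_comm]
  · rw [← Set.ncard_eq_toFinset_card, ← MulAction.index_stabilizer, ConjAct.stabilizer_eq_centralizer]
    exact hk

end burn
end KW

namespace KW
open Subgroup
open scoped Pointwise

set_option linter.unusedSectionVars false
set_option linter.style.haveILetI false

section kegel
variable {G : Type*} [Group G] [Finite G]

theorem card_set (H K : Subgroup G) :
    Nat.card H * Nat.card K = ((H : Set G) * (K : Set G)).ncard * Nat.card (H ⊓ K : Subgroup G) := by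
  have hx : ∀ x : ((H : Set G) * (K : Set G) : Set G), ∃ w : G × G, w.1 ∈ H ∧ w.2 ∈ K ∧ w.1 * w.2 = x := by
    rintro ⟨_, h, hh, k, hk, rfl⟩
    exact ⟨(h, k), hh, hk, rfl⟩
  choose w hw1 hw2 hw3 using hx
  rw [← Nat.card_coe_set_eq, ← Nat.card_prod, ← Nat.card_prod]
  symm
  refine Nat.card_eq_of_bijective (fun q : ((H : Set G) * (K : Set G) : Set G) × (H ⊓ K : Subgroup G) =>
    ((⟨(w q.1).1 * q.2, mul_mem (hw1 _) q.2.2.1⟩ : H), (⟨(q.2 : G)⁻¹ * (w q.1).2,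
      mul_mem (inv_mem q.2.2.2) (hw2 _)⟩ : K))) ⟨?_, ?_⟩
  · rintro ⟨x, d⟩ ⟨x', d'⟩ h
    simp only [Prod.mk.injEq, Subtype.mk.injEq] at h
    have hxx : x = x' := by
      apply Subtype.ext
      rw [← hw3, ← hw3]
      have := congrArg₂ (· * ·) h.1 h.2
      simpa [mul_assoc] using this
    subst hxx
    have := mul_left_cancel h.1
    rw [Subtype.ext this]
  · rintro ⟨⟨h, hh⟩, ⟨k, hk⟩⟩
    let x : ((H : Set G) * (K : Set G) : Set G) := ⟨h * k, Set.mul_mem_mul hh hk⟩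
    have e : (w x).1 * (w x).2 = h * k := hw3 x
    have e2 : (w x).1⁻¹ * h = (w x).2 * k⁻¹ := by
      rw [inv_mul_eq_iff_eq_mul, ← mul_assoc, e]; group
    refine ⟨⟨x, ⟨(w x).1⁻¹ * h, mem_inf.2 ⟨mul_mem (inv_mem (hw1 x)) hh, ?_⟩⟩⟩, ?_⟩
    · rw [e2]; exact mul_mem (hw2 x) (inv_mem hk)
    · simp only [Prod.mk.injEq, Subtype.mk.injEq]
      refine ⟨by group, ?_⟩
      rw [e2]; group

theorem perm_one {A B : Subgroup G} (nA : Group.IsNilpotent A) (nB : Group.IsNilpotent B)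
    (prod : ∀ g : G, ∃ a ∈ A, ∃ b ∈ B, g = a * b) (p : ℕ) [hp : Fact p.Prime] {x y : G}
    (hx : x ∈ pp A p) (hy : y ∈ pp B p) : ∃ x' ∈ pp A p, ∃ y' ∈ pp B p, y * x = x' * y' := by
  obtain ⟨S, hS, hAS⟩ := exists_isSyl (p := p) (le_top : pp A p ≤ ⊤) (pp_isPGroup A p)
  obtain ⟨g, -, hg⟩ := hS.conj_le (le_top : pp B p ≤ ⊤) (pp_isPGroup B p)
  obtain ⟨a, ha, b, hb, rfl⟩ := prod g
  let S' := S.comap (MulAut.conj a).toMonoidHom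
  have hcS : Nat.card S' = Nat.card S := by
    refine Nat.card_congr (Equiv.subtypeEquiv (MulAut.conj a).toEquiv ?_)
    intro z; rfl
  have hA' : pp A p ≤ S' := by
    intro z hz
    exact hAS (conj_mem (le_normalizer_pp A p ha) hz)
  have hB' : pp B p ≤ S' := by
    intro z hz
    have := hg _ (conj_mem (le_normalizer_pp B p (inv_mem hb)) hz)
    change a * z * a⁻¹ ∈ S
    convert this using 1
    group
  have hsub : (pp A p : Set G) * (pp B p : Set G) ⊆ S' := by
    rintro _ ⟨u, hu, v, hv, rfl⟩
    exact mul_mem (hA' hu) (hB' hv)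
  have h1 := card_set A B
  have hAB : (A : Set G) * (B : Set G) = Set.univ := by
    refine Set.eq_univ_of_forall fun z => ?_
    obtain ⟨a, ha, b, hb, rfl⟩ := prod z
    exact Set.mul_mem_mul ha hb
  rw [hAB, Set.ncard_univ] at h1
  have h2 := card_set (pp A p) (pp B p)
  have h3 : (Nat.card A).factorization p + (Nat.card B).factorization p =
      (Nat.card G).factorization p + (Nat.card (A ⊓ B : Subgroup G)).factorization p := by
    have := congrArg (fun n => n.factorization p) h1
    rwa [Nat.factorization_mul Nat.card_pos.ne' Nat.card_pos.ne',
      Nat.factorization_mul Nat.card_pos.ne' Nat.card_pos.ne'] at this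
  have h4 : Nat.card (pp A p ⊓ pp B p : Subgroup G) ≤ p ^ (Nat.card (A ⊓ B : Subgroup G)).factorization p := by
    have hpg : IsPGroup p (pp A p ⊓ pp B p : Subgroup G) := (pp_isPGroup A p).to_le inf_le_left
    obtain ⟨j, hj⟩ := hpg.exists_card_eq
    rw [hj]
    apply Nat.pow_le_pow_right hp.out.pos
    rw [← hp.out.pow_dvd_iff_le_factorization Nat.card_pos.ne', ← hj]
    exact card_dvd_of_le (inf_le_inf (pp_le A p) (pp_le B p))
  have h5 : Nat.card S' = p ^ (Nat.card G).factorization p := by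
    rw [hcS, hS.card, card_top]
  have h6 : (S' : Set G).ncard ≤ ((pp A p : Set G) * (pp B p : Set G)).ncard := by
    have e : (S' : Set G).ncard = p ^ (Nat.card G).factorization p := h5
    rw [e]
    rw [pp_card nA, pp_card nB, ← pow_add, h3, pow_add] at h2
    have hpos : 0 < p ^ (Nat.card (A ⊓ B : Subgroup G)).factorization p := pow_pos hp.out.pos _
    have h7 := Nat.mul_le_mul_left ((pp A p : Set G) * (pp B p : Set G)).ncard h4
    rw [← h2] at h7
    exact Nat.le_of_mul_le_mul_right h7 hpos
  have h8 := Set.eq_of_subset_of_ncard_le hsub h6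
  have h9 : y * x ∈ (S' : Set G) := mul_mem (hB' hy) (hA' hx)
  rw [← h8] at h9
  obtain ⟨u, hu, v, hv, e⟩ := h9
  exact ⟨u, hu, v, hv, e.symm⟩

/-- all conjugates permute -/
theorem perm_all {A B : Subgroup G} (nA : Group.IsNilpotent A) (nB : Group.IsNilpotent B)
    (prod : ∀ g : G, ∃ a ∈ A, ∃ b ∈ B, g = a * b) (p : ℕ) [hp : Fact p.Prime] {x y g h : G}
    (hx : g⁻¹ * x * g ∈ pp A p) (hy : h⁻¹ * y * h ∈ pp B p) :
    ∃ x' y', g⁻¹ * x' * g ∈ pp A p ∧ h⁻¹ * y' * h ∈ pp B p ∧ y * x = x' * y' := by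
  obtain ⟨a, ha, b, hb, e⟩ := prod (g⁻¹ * h)
  have hgh : g * a = h * b⁻¹ := by
    have : h = g * (a * b) := by rw [← e]; group
    rw [this]; group
  set k := g * a with hk
  have hkA : ∀ z, g⁻¹ * z * g ∈ pp A p ↔ k⁻¹ * z * k ∈ pp A p := by
    intro z
    have := mem_normalizer_iff.1 (le_normalizer_pp A p (inv_mem ha)) (g⁻¹ * z * g)
    rw [this, hk]
    have : a⁻¹ * (g⁻¹ * z * g) * a⁻¹⁻¹ = (g * a)⁻¹ * z * (g * a) := by group
    rw [this]
  have hkB : ∀ z, h⁻¹ * z * h ∈ pp B p ↔ k⁻¹ * z * k ∈ pp B p := by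
    intro z
    have := mem_normalizer_iff.1 (le_normalizer_pp B p hb) (h⁻¹ * z * h)
    rw [this, hgh]
    have : b * (h⁻¹ * z * h) * b⁻¹ = (h * b⁻¹)⁻¹ * z * (h * b⁻¹) := by group
    rw [this]
  rw [hkA] at hx
  rw [hkB] at hy
  obtain ⟨x', hx', y', hy', e'⟩ := perm_one nA nB prod p hx hy
  refine ⟨k * x' * k⁻¹, k * y' * k⁻¹, ?_, ?_, ?_⟩
  · rw [hkA]; convert hx' using 1; group
  · rw [hkB]; convert hy' using 1; group
  · have : y * x = k * (k⁻¹ * y * k * (k⁻¹ * x * k)) * k⁻¹ := by group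
    rw [this, e']; group

/-- subgroup generated by conjugates of `P` -/
def gen (P : Subgroup G) (T : Set G) : Subgroup G := closure {x | ∃ g ∈ T, g⁻¹ * x * g ∈ P}

theorem gen_mono {P : Subgroup G} {T T' : Set G} (h : T ⊆ T') : gen P T ≤ gen P T' :=
  closure_mono fun _ ⟨g, hg, hx⟩ => ⟨g, h hg, hx⟩

theorem mem_gen {P : Subgroup G} {T : Set G} {g x : G} (hg : g ∈ T) (hx : g⁻¹ * x * g ∈ P) :
    x ∈ gen P T := subset_closure ⟨g, hg, hx⟩

theorem perm_gen {A B : Subgroup G} (nA : Group.IsNilpotent A) (nB : Group.IsNilpotent B)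
    (prod : ∀ g : G, ∃ a ∈ A, ∃ b ∈ B, g = a * b) (p : ℕ) [hp : Fact p.Prime] {T : Set G} {u h : G}
    (hu : u ∈ gen (pp A p) T) : ∀ y, h⁻¹ * y * h ∈ pp B p →
    ∃ u' y', u' ∈ gen (pp A p) T ∧ h⁻¹ * y' * h ∈ pp B p ∧ y * u = u' * y' := by
  have key : ∀ x z, (∃ g ∈ T, g⁻¹ * x * g ∈ pp A p) → (∀ y, h⁻¹ * y * h ∈ pp B p →
      ∃ u' y', u' ∈ gen (pp A p) T ∧ h⁻¹ * y' * h ∈ pp B p ∧ y * z = u' * y') →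
      ∀ y, h⁻¹ * y * h ∈ pp B p →
      ∃ u' y', u' ∈ gen (pp A p) T ∧ h⁻¹ * y' * h ∈ pp B p ∧ y * (x * z) = u' * y' := by
    rintro x z ⟨g, hg, hx⟩ ih y hy
    obtain ⟨x', y', hx', hy', e⟩ := perm_all nA nB prod p hx hy
    obtain ⟨u'', y'', hu'', hy'', e'⟩ := ih y' hy'
    refine ⟨x' * u'', y'', mul_mem (mem_gen hg hx') hu'', hy'', ?_⟩
    rw [← mul_assoc, e, mul_assoc, e', mul_assoc]
  refine closure_induction_left (p := fun u _ => ∀ y, h⁻¹ * y * h ∈ pp B p →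
    ∃ u' y', u' ∈ gen (pp A p) T ∧ h⁻¹ * y' * h ∈ pp B p ∧ y * u = u' * y') ?_ ?_ ?_ hu
  · intro y hy
    exact ⟨1, y, one_mem _, hy, by simp⟩
  · intro x hx z _ ih
    exact key x z hx ih
  · rintro x ⟨g, hg, hx⟩ z _ ih
    refine key x⁻¹ z ⟨g, hg, ?_⟩ ih
    have := inv_mem hx
    convert this using 1
    group

/-- product of a `p`-subgroup and a permuting `p`-subgroup -/
theorem pgroup_sup {p : ℕ} [hp : Fact p.Prime] {U Y : Subgroup G} (hU : IsPGroup p U) (hY : IsPGroup p Y)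
    (h : ∀ u ∈ U, ∀ y ∈ Y, ∃ u' ∈ U, ∃ y' ∈ Y, y * u = u' * y') :
    ∃ W : Subgroup G, IsPGroup p W ∧ U ≤ W ∧ Y ≤ W := by
  let W : Subgroup G :=
    { carrier := (U : Set G) * (Y : Set G)
      one_mem' := ⟨1, one_mem _, 1, one_mem _, by simp⟩
      mul_mem' := by
        rintro _ _ ⟨u, hu, y, hy, rfl⟩ ⟨v, hv, z, hz, rfl⟩
        obtain ⟨u', hu', y', hy', e⟩ := h v hv y hy
        refine ⟨u * u', mul_mem hu hu', y' * z, mul_mem hy' hz, ?_⟩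
        calc u * u' * (y' * z) = u * (u' * y') * z := by group
          _ = u * y * (v * z) := by rw [← e]; group
      inv_mem' := by
        rintro _ ⟨u, hu, y, hy, rfl⟩
        obtain ⟨u', hu', y', hy', e⟩ := h u⁻¹ (inv_mem hu) y⁻¹ (inv_mem hy)
        exact ⟨u', hu', y', hy', by change _ = (u * y)⁻¹; rw [mul_inv_rev]; exact e.symm⟩ }
  refine ⟨W, ?_, fun u hu => ⟨u, hu, 1, one_mem _, by simp⟩, fun y hy => ⟨1, one_mem _, y, hy, by simp⟩⟩
  obtain ⟨i, hi⟩ := hU.exists_card_eq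
  obtain ⟨j, hj⟩ := hY.exists_card_eq
  have h1 := card_set U Y
  rw [hi, hj, ← pow_add] at h1
  have h2 : Nat.card W ∣ p ^ (i + j) := ⟨_, h1⟩
  obtain ⟨m, -, hm⟩ := (Nat.dvd_prime_pow hp.out).1 h2
  exact IsPGroup.of_card hm

/-- Lemma K: a `p`-subgroup containing `A_p`, normalized by all conjugates of `B_p` -/
theorem lemmaK {A B : Subgroup G} (nA : Group.IsNilpotent A) (nB : Group.IsNilpotent B)
    (prod : ∀ g : G, ∃ a ∈ A, ∃ b ∈ B, g = a * b) (p : ℕ) [hp : Fact p.Prime] :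
    ∃ U : Subgroup G, IsPGroup p U ∧ pp A p ≤ U ∧
      ∀ h y, h⁻¹ * y * h ∈ pp B p → y ∈ normalizer (U : Set G) := by
  have hf : ({U : Subgroup G | IsPGroup p U ∧ ∃ T : Set G, 1 ∈ T ∧ U = gen (pp A p) T}).Finite :=
    Set.toFinite _
  have hone : gen (pp A p) {1} = pp A p := by
    rw [gen]
    convert closure_eq (pp A p) using 2
    ext x
    simp
  obtain ⟨U, hU⟩ := hf.exists_maximal ⟨pp A p, pp_isPGroup A p, {1}, rfl, hone.symm⟩
  obtain ⟨⟨hUp, T, hT1, rfl⟩, hmax⟩ := hU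
  refine ⟨gen (pp A p) T, hUp, fun x hx => mem_gen hT1 (by simpa using hx), ?_⟩
  intro h y hy
  let Y : Subgroup G := (pp B p).comap (MulAut.conj h⁻¹).toMonoidHom
  have hYm : ∀ z, z ∈ Y ↔ h⁻¹ * z * h ∈ pp B p := by
    intro z
    change h⁻¹ * z * h⁻¹⁻¹ ∈ pp B p ↔ _
    rw [inv_inv]
  have hYp : IsPGroup p Y := (pp_isPGroup B p).comap_of_injective _ (MulAut.conj h⁻¹).injective
  obtain ⟨W, hWp, hUW, hYW⟩ := pgroup_sup hUp hYp (by
    intro u hu z hz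
    obtain ⟨u', y', h1, h2, h3⟩ := perm_gen nA nB prod p hu z ((hYm z).1 hz)
    exact ⟨u', h1, y', (hYm _).2 h2, h3⟩)
  have hyW : y ∈ W := hYW ((hYm y).2 hy)
  let T' : Set G := T ∪ {k | ∃ t ∈ T, k = y * t}
  have hT'W : gen (pp A p) T' ≤ W := by
    rw [gen, closure_le]
    rintro x ⟨g, hg | ⟨t, ht, rfl⟩, hx⟩
    · exact hUW (mem_gen hg hx)
    · have h1 : y⁻¹ * x * y ∈ gen (pp A p) T := mem_gen ht (by convert hx using 1; group)
      have h2 := mul_mem (mul_mem hyW (hUW h1)) (inv_mem hyW)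
      have h3 : y * (y⁻¹ * x * y) * y⁻¹ = x := by group
      rwa [h3] at h2
  have hle := hmax (y := gen (pp A p) T') ⟨hWp.to_le hT'W, T', Or.inl hT1, rfl⟩
    (gen_mono Set.subset_union_left)
  apply mem_norm_of_conj
  intro x hx
  have h4 : gen (pp A p) T ≤ (gen (pp A p) T).comap (MulAut.conj y).toMonoidHom := by
    conv_lhs => rw [gen]
    rw [closure_le]
    rintro z ⟨t, ht, hz⟩
    apply hle
    refine mem_gen (g := y * t) (Or.inr ⟨t, ht, rfl⟩) ?_
    change (y * t)⁻¹ * (y * z * y⁻¹) * (y * t) ∈ pp A p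
    convert hz using 1
    group
  exact h4 hx

end kegel
end KW

namespace KW
open Subgroup

set_option linter.unusedSectionVars false
set_option linter.style.haveILetI false

universe u

section mc
variable {G : Type u} [Group G] [Finite G]

/-- minimal counterexample to the theorem of Kegel -/
structure MC (A B : Subgroup G) : Prop where
  nA : Group.IsNilpotent A
  nB : Group.IsNilpotent B
  prod : ∀ g : G, ∃ a ∈ A, ∃ b ∈ B, g = a * b
  ihs : ∀ H : Subgroup G, H ≠ ⊤ → ∀ X Z : Subgroup G, X ≤ H → Z ≤ H → Group.IsNilpotent X →
    Group.IsNilpotent Z → (∀ h ∈ H, ∃ x ∈ X, ∃ z ∈ Z, h = x * z) → Group.IsSolvable H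
  ihq : ∀ (N : Subgroup G) (_ : N.Normal), N ≠ ⊥ → Group.IsSolvable (G ⧸ N)
  ns : ¬ Group.IsSolvable G

variable {A B : Subgroup G}

namespace MC

theorem prod' (c : MC A B) (g : G) : ∃ b ∈ B, ∃ a ∈ A, g = b * a :=
  prod_symm (H := ⊤) (X := A) (Z := B) (fun g _ => c.prod g) g trivial

theorem symm (c : MC A B) : MC B A := ⟨c.nB, c.nA, c.prod', c.ihs, c.ihq, c.ns⟩

theorem nosolv (c : MC A B) {N : Subgroup G} (hN : N.Normal) (hs : Group.IsSolvable N) : N = ⊥ := by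
  by_contra h
  haveI := c.ihq N hN h
  exact c.ns (Group.isSolvable_of_ker_le_range N.subtype (QuotientGroup.mk' N) (by simp))

theorem cen (c : MC A B) (z : G) (hz : ∀ g, g * z = z * g) : z = 1 := by
  have h1 : center G = ⊥ := c.nosolv inferInstance
    (Group.isSolvable_of_comm fun a b => Subtype.ext (mem_center_iff.1 b.2 a))
  have h2 : z ∈ center G := mem_center_iff.2 hz
  rwa [h1, mem_bot] at h2

theorem nopgroup (c : MC A B) {N : Subgroup G} (hN : N.Normal) {p : ℕ} [Fact p.Prime]
    (hp : IsPGroup p N) : N = ⊥ := by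
  haveI := hp.isNilpotent
  exact c.nosolv hN inferInstance

theorem sup_top (c : MC A B) {N : Subgroup G} (hN : N.Normal) (h : N ≠ ⊥) : A ⊔ N = ⊤ := by
  by_contra ht
  have hs : Group.IsSolvable (A ⊔ N : Subgroup G) := by
    refine c.ihs _ ht A (B ⊓ (A ⊔ N)) le_sup_left inf_le_right c.nA (nilp_mono inf_le_left c.nB) ?_
    intro x hx
    obtain ⟨a, ha, b, hb, rfl⟩ := c.prod x
    refine ⟨a, ha, b, ⟨hb, ?_⟩, rfl⟩
    exact (mul_mem_cancel_left (mem_sup_left ha)).1 hx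
  exact h (c.nosolv hN (solv_mono le_sup_right hs))

theorem pp_trivial (c : MC A B) (p : ℕ) [hp : Fact p.Prime] : pp A p = ⊥ ∨ pp B p = ⊥ := by
  by_contra hcon
  push Not at hcon
  obtain ⟨hA, hB⟩ := hcon
  obtain ⟨U, hU, hAU, hn⟩ := lemmaK c.nA c.nB c.prod p
  let L := normalClosure (pp B p : Set G)
  have hLn : L.Normal := normalClosure_normal
  have hLU : L ≤ normalizer (U : Set G) := by
    change Subgroup.closure _ ≤ _
    rw [closure_le]
    intro y hy
    obtain ⟨w, hw, hc⟩ := Group.mem_conjugatesOfSet_iff.1 hy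
    obtain ⟨h, rfl⟩ := isConj_iff.1 hc
    refine hn h _ ?_
    have e : h⁻¹ * (h * w * h⁻¹) * h = w := by group
    rw [e]; exact hw
  have hUL : U ⊓ L = ⊥ := by
    have h1 : U ⊓ L ≤ pp L p := by
      refine le_pp inf_le_right (hU.to_le inf_le_left) ?_
      intro l hl
      apply mem_norm_of_conj
      rintro x ⟨hx1, hx2⟩
      exact ⟨conj_mem (hLU hl) hx1, hLn.conj_mem _ hx2 _⟩
    have h2 : pp L p = ⊥ := c.nopgroup (normal_of_normalizer fun g =>
      normalizer_le_normalizer_pp L p (normalizer_of_normal hLn g)) (pp_isPGroup L p)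
    rw [h2] at h1
    exact le_bot_iff.1 h1
  have hUC : U ≤ centralizer (L : Set G) := by
    intro x hx
    rw [mem_centralizer_iff]
    intro l hl
    have h1 : x * (l * x⁻¹ * l⁻¹) ∈ U ⊓ L := by
      refine ⟨mul_mem hx (conj_mem (hLU hl) (inv_mem hx)), ?_⟩
      have := mul_mem (hLn.conj_mem l hl x) (inv_mem hl)
      simpa [mul_assoc] using this
    rw [hUL, mem_bot] at h1
    have : x * l = l * x := by
      have h2 : x * (l * x⁻¹ * l⁻¹) = x * l * (l * x)⁻¹ := by group
      rw [h2, mul_inv_eq_one] at h1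
      exact h1
    exact this.symm
  have hCn : (centralizer (L : Set G)).Normal := inferInstance
  have hLne : L ≠ ⊥ := by
    intro h
    apply hB
    rw [← le_bot_iff, ← h]
    exact subset_normalClosure
  have hd : centralizer (L : Set G) ⊓ L = ⊥ := by
    refine c.nosolv inferInstance ?_
    refine Group.isSolvable_of_comm ?_
    rintro ⟨x, hx1, hx2⟩ ⟨y, hy1, hy2⟩
    exact Subtype.ext (mem_centralizer_iff.1 hy1 x hx2)
  have hC : Group.IsSolvable (centralizer (L : Set G)) := by
    haveI := c.ihq L hLn hLne
    refine Group.isSolvable_of_isSolvable_injective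
      (f := (QuotientGroup.mk' L).comp (centralizer (L : Set G)).subtype) ?_
    rw [← MonoidHom.ker_eq_bot_iff, eq_bot_iff]
    rintro ⟨x, hx⟩ hk
    have h1 : x ∈ L := (QuotientGroup.eq_one_iff x).1 hk
    have h2 : x ∈ centralizer (L : Set G) ⊓ L := ⟨hx, h1⟩
    rw [hd, mem_bot] at h2
    exact Subtype.ext h2
  have hCb := c.nosolv hCn hC
  apply hA
  rw [← le_bot_iff, ← hCb]
  exact hAU.trans hUC

theorem cop (c : MC A B) : Nat.Coprime (Nat.card A) (Nat.card B) := by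
  apply Nat.coprime_of_dvd
  intro p hp h1 h2
  haveI : Fact p.Prime := ⟨hp⟩
  rcases c.pp_trivial p with h | h
  · exact pp_ne_bot c.nA h1 h
  · exact pp_ne_bot c.nB h2 h

theorem index_dvd (c : MC A B) {N : Subgroup G} (hN : N.Normal) (h : N ≠ ⊥) :
    N.index ∣ Nat.card A := by
  have h1 := relIndex_sup_right A N
  rw [c.sup_top hN h, relIndex_top_right] at h1
  rw [h1]
  exact relIndex_dvd_card N A

theorem simple (c : MC A B) (N : Subgroup G) (hN : N.Normal) : N = ⊥ ∨ N = ⊤ := by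
  by_cases h : N = ⊥
  · exact Or.inl h
  · right
    rw [← index_eq_one]
    exact Nat.eq_one_of_dvd_coprimes c.cop (c.index_dvd hN h) (c.symm.index_dvd hN h)

theorem two (c : MC A B) (p : ℕ) : ∃ q, q.Prime ∧ q ≠ p ∧ q ∣ Nat.card A := by
  by_contra hcon
  push Not at hcon
  have hA : ∃ r k : ℕ, r.Prime ∧ Nat.card A = r ^ k := by
    have h1 := Nat.eq_prime_pow_of_unique_prime_dvd (n := Nat.card A) (p := p) Nat.card_pos.ne'
      (fun {d} hd hdv => by
        by_contra hne
        exact hcon d hd hne hdv)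
    by_cases hp : p.Prime
    · exact ⟨p, _, hp, h1⟩
    · refine ⟨2, 0, Nat.prime_two, ?_⟩
      rw [pow_zero]
      by_contra hne
      obtain ⟨q, hq, hqd⟩ := Nat.exists_prime_and_dvd hne
      by_cases hqp : q = p
      · exact hp (hqp ▸ hq)
      · exact hcon q hq hqp hqd
  obtain ⟨r, k, hr, hA⟩ := hA
  have hB1 : Nat.card B ≠ 1 := by
    intro hB
    rw [card_eq_one] at hB
    have hAt : A = ⊤ := by
      rw [eq_top_iff]
      intro x _
      obtain ⟨a, ha, b, hb, rfl⟩ := c.prod x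
      rw [hB, mem_bot] at hb
      rw [hb, mul_one]; exact ha
    have hn := c.nA
    have hs : Group.IsSolvable A := inferInstance
    rw [hAt] at hs
    exact c.ns (Group.isSolvable_of_isSolvable_injective (f := (topEquiv (G := G)).symm.toMonoidHom)
      (topEquiv (G := G)).symm.injective)
  obtain ⟨s, hs, hsd⟩ := Nat.exists_prime_and_dvd hB1
  haveI : Fact s.Prime := ⟨hs⟩
  obtain ⟨z, hz, hz1, hzc⟩ := exists_central (p := s) c.nB le_rfl (pp_ne_bot c.nB hsd) le_normalizer
  have hle : B ≤ centralizer {z} := by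
    intro b hb
    rw [mem_centralizer_singleton_iff]
    exact hzc b hb
  have hBi : B.index = Nat.card A := by
    have h1 := card_prod (H := ⊤) le_top le_top c.cop (fun g _ => c.prod g)
    have h2 := B.card_mul_index
    rw [card_top] at h1
    rw [h1, mul_comm] at h2
    exact Nat.eq_of_mul_eq_mul_right Nat.card_pos h2
  have hdv : (centralizer {z}).index ∣ r ^ k := by
    rw [← hA, ← hBi]
    exact index_dvd_of_le hle
  obtain ⟨j, -, hj⟩ := (Nat.dvd_prime_pow hr).1 hdv
  exact burnside c.simple c.cen hz1 hr hj

theorem absurd (c : MC A B) : False :=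
  Ctx.absurd (A := A) (B := B) ⟨c.simple, c.cen, c.nA, c.nB, c.cop, c.prod,
    fun H hH X Z hX hZ nX nZ _ pr => c.ihs H hH X Z hX hZ nX nZ pr, c.two, c.symm.two⟩

end MC
end mc

/-- The theorem of Kegel -/
theorem kegel_aux (n : ℕ) : ∀ (G : Type u) [Group G] [Finite G], Nat.card G = n →
    ∀ A B : Subgroup G, Group.IsNilpotent A → Group.IsNilpotent B →
    (∀ g : G, ∃ a ∈ A, ∃ b ∈ B, g = a * b) → Group.IsSolvable G := by
  induction n using Nat.strong_induction_on with
  | _ n ih =>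
  intro G _ _ hn A B nA nB prod
  by_contra ns
  refine MC.absurd (A := A) (B := B) ⟨nA, nB, prod, ?_, ?_, ns⟩
  · intro H hH X Z hX hZ nX nZ pr
    have hlt : Nat.card H < n := by
      rw [← hn]
      exact lt_of_le_of_ne (Subgroup.card_le_card_group H) (fun h => hH (eq_top_of_card_eq H h))
    refine ih _ hlt H rfl (X.subgroupOf H) (Z.subgroupOf H)
      (Group.nilpotent_of_mulEquiv (subgroupOfEquivOfLe hX).symm)
      (Group.nilpotent_of_mulEquiv (subgroupOfEquivOfLe hZ).symm) ?_
    rintro ⟨h, hh⟩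
    obtain ⟨x, hx, z, hz, e⟩ := pr h hh
    exact ⟨⟨x, hX hx⟩, hx, ⟨z, hZ hz⟩, hz, Subtype.ext e⟩
  · intro N hN hne
    have hlt : Nat.card (G ⧸ N) < n := by
      rw [← hn, ← N.card_mul_index]
      change N.index < _
      have h1 : 1 < Nat.card N := (one_lt_card_iff_ne_bot N).2 hne
      have h2 : 0 < N.index := Nat.pos_of_ne_zero index_ne_zero_of_finite
      nlinarith
    refine ih _ hlt (G ⧸ N) rfl (A.map (QuotientGroup.mk' N)) (B.map (QuotientGroup.mk' N)) ?_ ?_ ?_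
    · exact Group.nilpotent_of_surjective ((QuotientGroup.mk' N).subgroupMap A)
        ((QuotientGroup.mk' N).subgroupMap_surjective A)
    · exact Group.nilpotent_of_surjective ((QuotientGroup.mk' N).subgroupMap B)
        ((QuotientGroup.mk' N).subgroupMap_surjective B)
    · intro q
      obtain ⟨g, rfl⟩ := QuotientGroup.mk'_surjective N q
      obtain ⟨a, ha, b, hb, rfl⟩ := prod g
      exact ⟨_, mem_map_of_mem _ ha, _, mem_map_of_mem _ hb, map_mul _ _ _⟩

theorem brace_aux {N C : Type u} [Group N] [Group C] [Finite N] [Finite C] (e : C ≃ N)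
    (h : ∀ a b c : C, e (a * e.symm (e b * e c)) = e (a * b) * (e a)⁻¹ * e (a * c))
    (hC : Group.IsNilpotent C) : Group.IsSolvable N := by
  have h' : ∀ (a : C) (x y : N), e (a * e.symm (x * y)) =
      e (a * e.symm x) * (e a)⁻¹ * e (a * e.symm y) := by
    intro a x y
    have := h a (e.symm x) (e.symm y)
    simpa using this
  have e1 : e 1 = 1 := by
    have := h 1 1 1
    simp only [one_mul, Equiv.apply_symm_apply, mul_one] at this
    simpa using this
  have hinv : ∀ (a : C) (x : N), e (a * e.symm (e (a⁻¹ * e.symm x))) = x := by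
    intro a x; simp
  let lam : C → N → N := fun a x => (e a)⁻¹ * e (a * e.symm x)
  have lam_mul : ∀ a x y, lam a (x * y) = lam a x * lam a y := by
    intro a x y
    simp only [lam, h', mul_assoc]
  let lamH : C → (N →* N) := fun a => MonoidHom.mk' (lam a) (lam_mul a)
  have lam_comp : ∀ a b x, lam (a * b) x = lam a (lam b x) := by
    intro a b x
    have h1 : lam a ((e b)⁻¹) = (lam a (e b))⁻¹ := map_inv (lamH a) (e b)
    have h2 : lam b x = (e b)⁻¹ * e (b * e.symm x) := rfl
    rw [h2, lam_mul, h1]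
    simp only [lam, Equiv.symm_apply_apply, mul_assoc, mul_inv_rev, inv_inv, mul_inv_cancel_left]
  have lam_one : ∀ x, lam 1 x = x := by
    intro x; simp [lam, e1]
  let φ : C →* MulAut N :=
    { toFun := fun a =>
        { toFun := lam a
          invFun := lam a⁻¹
          left_inv := fun x => by rw [← lam_comp, inv_mul_cancel, lam_one]
          right_inv := fun x => by rw [← lam_comp, mul_inv_cancel, lam_one]
          map_mul' := lam_mul a }
      map_one' := by ext x; exact lam_one x
      map_mul' := fun a b => by ext x; exact lam_comp a b x }
  have hφ : ∀ a x, φ a x = (e a)⁻¹ * e (a * e.symm x) := fun a x => rfl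
  let d : C →* N ⋊[φ] C :=
    { toFun := fun c => ⟨e c, c⟩
      map_one' := by ext <;> simp [e1]
      map_mul' := fun a b => by
        ext
        · simp [hφ]
        · simp }
  haveI : Finite (N ⋊[φ] C) := Finite.of_equiv _ (SemidirectProduct.equivProd).symm
  have hs : Group.IsSolvable (N ⋊[φ] C) := by
    refine kegel_aux _ _ rfl d.range (SemidirectProduct.inr (φ := φ)).range ?_ ?_ ?_
    · exact Group.nilpotent_of_surjective d.rangeRestrict d.rangeRestrict_surjective
    · exact Group.nilpotent_of_surjective (SemidirectProduct.inr (φ := φ)).rangeRestrict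
        (SemidirectProduct.inr (φ := φ)).rangeRestrict_surjective
    · rintro ⟨x, c⟩
      refine ⟨d (e.symm x), ⟨_, rfl⟩, SemidirectProduct.inr ((e.symm x)⁻¹ * c), ⟨_, rfl⟩, ?_⟩
      ext
      · simp [d]
      · simp [d]
  exact Group.isSolvable_of_isSolvable_injective (f := SemidirectProduct.inl (φ := φ))
    SemidirectProduct.inl_injective

end KW

/-- Let `(G, ·, ∘)` be a finite skew left brace (here `gm` is the additive group structure
`·` and `gc` the multiplicative one `∘`). If `(G, ∘)` is nilpotent, then `(G, ·)` is
solvable. -/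
theorem stmt_11 (G : Type*) [Finite G] (gm gc : Group G)
    (hbrace : ∀ a b c : G,
      gc.mul a (gm.mul b c) = gm.mul (gm.mul (gc.mul a b) (gm.inv a)) (gc.mul a c))
    (hnilp : @Group.IsNilpotent G gc) :
    @IsSolvable G gm := by
  exact @KW.brace_aux G G gm gc _ _ (Equiv.refl G) (fun a b c => hbrace a b c) hnilp
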